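/- A language L ⊆ Σ* is a parsing expression language if and only if L is recognized by some one-way deterministic pointer pushdown automaton; that is, well-formed parsing expression grammars and one-way DPPDAs recognize exactly the same class of languages. -/

import Mathlib

/-! ### Parsing expression grammars -/

/-- Parsing expressions over nonterminals `N` and input alphabet `A`:
`ε`, terminals, nonterminals, sequence, prioritized choice, not-predicate. -/
inductive PExp (N A : Type) : Type where
  | eps : PExp N A
  | term : A → PExp N A
  | nt : N → PExp N A
  | seq : PExp N A → PExp N A → PExp N A
  | choice : PExp N A → PExp N A → PExp N A
  | not : PExp N A → PExp N A

/-- A parsing expression grammar: one rule per nonterminal, and an axiom. -/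
structure PEG (N A : Type) : Type where
  rule : N → PExp N A
  start : N

/-- Big-step relational semantics of the PEG parsing function `R`:
`Parses G e w r` means `R(e, w) = r`, where `r = none` encodes the failure `F`
and `r = some s` means that `e` consumed a prefix of `w` leaving the suffix `s`.
`R(e, w)` is defined iff `∃ r, Parses G e w r`. -/
inductive Parses {N A : Type} (G : PEG N A) : PExp N A → List A → Option (List A) → Prop where
  | eps (w : List A) : Parses G .eps w (some w)
  | term_ok (a : A) (s : List A) : Parses G (.term a) (a :: s) (some s)
  | term_mismatch {a b : A} (s : List A) (h : a ≠ b) : Parses G (.term a) (b :: s) none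
  | term_nil (a : A) : Parses G (.term a) [] none
  | nt {B : N} {w : List A} {r : Option (List A)} :
      Parses G (G.rule B) w r → Parses G (.nt B) w r
  | seq_ok {e₁ e₂ : PExp N A} {w w' : List A} {r : Option (List A)} :
      Parses G e₁ w (some w') → Parses G e₂ w' r → Parses G (.seq e₁ e₂) w r
  | seq_fail {e₁ e₂ : PExp N A} {w : List A} :
      Parses G e₁ w none → Parses G (.seq e₁ e₂) w none
  | choice_fst {e₁ e₂ : PExp N A} {w w' : List A} :
      Parses G e₁ w (some w') → Parses G (.choice e₁ e₂) w (some w')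
  | choice_snd {e₁ e₂ : PExp N A} {w : List A} {r : Option (List A)} :
      Parses G e₁ w none → Parses G e₂ w r → Parses G (.choice e₁ e₂) w r
  | not_succ {e : PExp N A} {w : List A} :
      Parses G e w none → Parses G (.not e) w (some w)
  | not_fail {e : PExp N A} {w w' : List A} :
      Parses G e w (some w') → Parses G (.not e) w none

/-- The language generated by a PEG: `L(G) = {w | R(S, w) = ε}`. -/
def PEG.Lang {N A : Type} (G : PEG N A) : Set (List A) :=
  {w | Parses G (.nt G.start) w (some [])}

/-- A PEG is complete if `R(S, w)` is defined for every input `w`. -/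
def PEG.Complete {N A : Type} (G : PEG N A) : Prop :=
  ∀ w : List A, ∃ r, Parses G (.nt G.start) w r

/-- Conservative test whether an expression could succeed without consuming input. -/
def PExp.maybeEmpty {N A : Type} : PExp N A → Bool
  | .eps => true
  | .term _ => false
  | .nt _ => true
  | .seq e₁ e₂ => e₁.maybeEmpty && e₂.maybeEmpty
  | .choice e₁ e₂ => e₁.maybeEmpty || e₂.maybeEmpty
  | .not _ => true

/-- The nonterminals that an expression can invoke without first consuming input. -/
def PExp.leftNts {N A : Type} : PExp N A → Set N
  | .eps => ∅
  | .term _ => ∅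
  | .nt B => {B}
  | .seq e₁ e₂ => e₁.leftNts ∪ (if e₁.maybeEmpty then e₂.leftNts else ∅)
  | .choice e₁ e₂ => e₁.leftNts ∪ e₂.leftNts
  | .not e => e.leftNts

/-- A PEG is well-formed if it has no (directly or mutually) left-recursive rules:
no nonterminal can reach an invocation of itself without consuming input. -/
def PEG.WellFormed {N A : Type} (G : PEG N A) : Prop :=
  ∀ B : N, ¬ Relation.TransGen (fun X Y : N => Y ∈ (G.rule X).leftNts) B B

/-- A language is a parsing expression language (PEL) if it is generated by some
well-formed PEG with a finite set of nonterminals. -/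
def IsPEL {A : Type} (L : Set (List A)) : Prop :=
  ∃ (N : Type) (_ : Finite N) (G : PEG N A), G.WellFormed ∧ G.Lang = L

/-! ### Deterministic pointer pushdown automata -/

/-- Tape symbols: the input letters plus the end markers `▷` and `◁`. -/
inductive TSym (A : Type) : Type where
  | lmark : TSym A
  | rmark : TSym A
  | sym : A → TSym A

/-- The symbol in cell `j` of the tape `▷w◁` (cell `0` holds `▷`, cell `|w|+1` holds `◁`). -/
def tapeNth {A : Type} (w : List A) (j : ℕ) : TSym A :=
  if j = 0 then .lmark
  else
    match w[j - 1]? with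
    | some a => .sym a
    | none => .rmark

/-- Head directions: move left, stay, return to the stored pointer, move right. -/
inductive Dir : Type where
  | left | down | up | right
deriving DecidableEq

/-- A (two-way) deterministic pointer pushdown automaton.  A transition
`trans q a Z = some (p, β, d)` pops `(Z, i)` when `β = []` (moving the head by `d`,
where `d = up` returns the head to the position `i` stored with `Z`), and pushes `β`
above `Z` when `β ≠ []` (moving the head by `d`).  Moves `↑` must pop (`α = ε`),
moving left off `▷` and right off `◁` is forbidden. -/
structure DPPDA (Q A Γ : Type) : Type where
  trans : Q → TSym A → Γ → Option (Q × List Γ × Dir)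
  init : Q
  Z0 : Γ
  final : Q → Bool
  up_pop : ∀ q a Z p β, trans q a Z = some (p, β, Dir.up) → β = []
  no_left_lmark : ∀ q Z p β, trans q TSym.lmark Z ≠ some (p, β, Dir.left)
  no_right_rmark : ∀ q Z p β, trans q TSym.rmark Z ≠ some (p, β, Dir.right)

/-- A configuration: state, stack of symbols tagged with the head position at which
they were pushed (top of the stack is the head of the list), and head position. -/
structure Conf (Q Γ : Type) : Type where
  state : Q
  stack : List (Γ × ℕ)
  pos : ℕ

/-- One move of a DPPDA on input `w` (`none` when no move is possible). -/
def DPPDA.step {Q A Γ : Type} (M : DPPDA Q A Γ) (w : List A) (c : Conf Q Γ) :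
    Option (Conf Q Γ) :=
  match c.stack with
  | [] => none
  | (Z, i) :: rest =>
    match M.trans c.state (tapeNth w c.pos) Z with
    | none => none
    | some (p, β, d) =>
      let j' : ℕ :=
        match d with
        | Dir.left => c.pos - 1
        | Dir.down => c.pos
        | Dir.up => i
        | Dir.right => c.pos + 1
      match β with
      | [] => some ⟨p, rest, j'⟩
      | X :: Xs => some ⟨p, ((X :: Xs).map fun Y => (Y, j')) ++ (Z, i) :: rest, j'⟩

/-- Reachability between configurations. -/
def DPPDA.Reaches {Q A Γ : Type} (M : DPPDA Q A Γ) (w : List A) :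
    Conf Q Γ → Conf Q Γ → Prop :=
  Relation.ReflTransGen (fun c c' => M.step w c = some c')

/-- Acceptance: from the initial configuration `(q₀, (Z₀, 0), 0)` the automaton
reaches the right end marker with empty stack in a final state. -/
def DPPDA.Accepts {Q A Γ : Type} (M : DPPDA Q A Γ) (w : List A) : Prop :=
  ∃ qf : Q, M.final qf = true ∧
    M.Reaches w ⟨M.init, [(M.Z0, 0)], 0⟩ ⟨qf, [], w.length + 1⟩

/-- A one-way DPPDA: moves with direction `←` are forbidden. -/
def DPPDA.OneWay {Q A Γ : Type} (M : DPPDA Q A Γ) : Prop :=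
  ∀ q a Z p β, M.trans q a Z ≠ some (p, β, Dir.left)

/-- A language is recognized by a one-way DPPDA if some one-way DPPDA with finitely
many states and stack symbols accepts exactly its words. -/
def RecognizedByDPPDA {A : Type} (L : Set (List A)) : Prop :=
  ∃ (Q Γ : Type) (_ : Finite Q) (_ : Finite Γ) (M : DPPDA Q A Γ),
    M.OneWay ∧ ∀ w : List A, M.Accepts w ↔ w ∈ L

/-! ### Basic facts on PEGs -/

namespace PelProof

section basic
variable {N A : Type} {G : PEG N A}

theorem Parses.det {e : PExp N A} {w : List A} {r r' : Option (List A)}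
    (h : Parses G e w r) (h' : Parses G e w r') : r = r' := by
  induction h generalizing r' with
  | eps w => cases h'; rfl
  | term_ok a s => cases h' with
    | term_ok => rfl
    | term_mismatch _ h => exact absurd rfl h
  | term_mismatch s h => cases h' with
    | term_ok => exact absurd rfl h
    | term_mismatch _ h => rfl
  | term_nil a => cases h'; rfl
  | nt _ ih => cases h' with
    | nt h => exact ih h
  | seq_ok _ _ ih1 ih2 => cases h' with
    | seq_ok h1 h2 =>
      have := ih1 h1
      simp only [Option.some.injEq] at this
      subst this
      exact ih2 h2
    | seq_fail h1 => have := ih1 h1; simp at this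
  | seq_fail _ ih1 => cases h' with
    | seq_ok h1 h2 => have := ih1 h1; simp at this
    | seq_fail h1 => rfl
  | choice_fst _ ih => cases h' with
    | choice_fst h => exact ih h
    | choice_snd h _ => have := ih h; simp at this
  | choice_snd _ _ ih1 ih2 => cases h' with
    | choice_fst h => have := ih1 h; simp at this
    | choice_snd _ h => exact ih2 h
  | not_succ _ ih => cases h' with
    | not_succ h => rfl
    | not_fail h => have := ih h; simp at this
  | not_fail _ ih => cases h' with
    | not_succ h => have := ih h; simp at this
    | not_fail h => rfl

theorem Parses.suffix_aux {e : PExp N A} {w : List A} {r : Option (List A)}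
    (h : Parses G e w r) : ∀ v, r = some v →
      v <:+ w ∧ (e.maybeEmpty = false → v.length < w.length) := by
  induction h with
  | eps w => rintro v ⟨⟩; simp [PExp.maybeEmpty]
  | term_ok a s => rintro v ⟨⟩; simp
  | term_mismatch s h => simp
  | term_nil a => simp
  | nt _ ih => intro v hv; exact ⟨(ih v hv).1, by simp [PExp.maybeEmpty]⟩
  | seq_ok _ _ ih1 ih2 =>
    intro v hv
    obtain ⟨a1, b1⟩ := ih1 _ rfl
    obtain ⟨a2, b2⟩ := ih2 _ hv
    refine ⟨a2.trans a1, ?_⟩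
    simp only [PExp.maybeEmpty, Bool.and_eq_false_iff]
    have := a1.length_le
    have := a2.length_le
    rintro (h | h)
    · have := b1 h; omega
    · have := b2 h; omega
  | seq_fail _ ih1 => simp
  | choice_fst _ ih =>
    intro v hv
    obtain ⟨a1, b1⟩ := ih _ hv
    refine ⟨a1, ?_⟩
    simp only [PExp.maybeEmpty, Bool.or_eq_false_iff]
    exact fun h => b1 h.1
  | choice_snd _ _ ih1 ih2 =>
    intro v hv
    obtain ⟨a1, b1⟩ := ih2 _ hv
    refine ⟨a1, ?_⟩
    simp only [PExp.maybeEmpty, Bool.or_eq_false_iff]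
    exact fun h => b1 h.2
  | not_succ _ ih => rintro v ⟨⟩; simp [PExp.maybeEmpty]
  | not_fail _ ih => simp

theorem total_expr (v : List A)
    (hs : ∀ u : List A, u.length < v.length → ∀ e, ∃ r, Parses G e u r) (e : PExp N A)
    (he : ∀ B ∈ e.leftNts, ∃ r, Parses G (.nt B) v r) : ∃ r, Parses G e v r := by
  induction e with
  | eps => exact ⟨_, .eps v⟩
  | term a =>
    cases v with
    | nil => exact ⟨_, .term_nil a⟩
    | cons b s =>
      by_cases h : a = b
      · subst h; exact ⟨_, .term_ok a s⟩
      · exact ⟨_, .term_mismatch s h⟩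
  | nt B => exact he B rfl
  | seq e1 e2 ih1 ih2 =>
    obtain ⟨r1, h1⟩ := ih1 (fun B hB => he B (Or.inl hB))
    cases r1 with
    | none => exact ⟨_, .seq_fail h1⟩
    | some u =>
      obtain ⟨hsuf, hlt⟩ := Parses.suffix_aux h1 u rfl
      by_cases hl : u.length < v.length
      · obtain ⟨r2, h2⟩ := hs u hl e2
        exact ⟨_, .seq_ok h1 h2⟩
      · have huv : u = v := hsuf.eq_of_length_le (by omega)
        have hm : e1.maybeEmpty = true := by
          by_contra hc
          exact hl (hlt (by simpa using hc))
        obtain ⟨r2, h2⟩ := ih2 (fun B hB => he B (Or.inr (by simpa [hm] using hB)))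
        subst huv
        exact ⟨_, .seq_ok h1 h2⟩
  | choice e1 e2 ih1 ih2 =>
    obtain ⟨r1, h1⟩ := ih1 (fun B hB => he B (Or.inl hB))
    obtain ⟨r2, h2⟩ := ih2 (fun B hB => he B (Or.inr hB))
    cases r1 with
    | none => exact ⟨_, .choice_snd h1 h2⟩
    | some u => exact ⟨_, .choice_fst h1⟩
  | not e ih =>
    obtain ⟨r1, h1⟩ := ih he
    cases r1 with
    | none => exact ⟨_, .not_succ h1⟩
    | some u => exact ⟨_, .not_fail h1⟩

theorem wf_left [Finite N] (hG : G.WellFormed) :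
    WellFounded (fun Y X : N => Y ∈ (G.rule X).leftNts) := by
  let T : N → N → Prop := fun Y X => Relation.TransGen (fun X Y : N => Y ∈ (G.rule X).leftNts) X Y
  have : IsTrans N T := ⟨fun a b c h1 h2 => Relation.TransGen.trans h2 h1⟩
  have : Std.Irrefl T := ⟨fun a h => hG a h⟩
  have hT : WellFounded T := Finite.wellFounded_of_trans_of_irrefl T
  exact Subrelation.wf (fun h => Relation.TransGen.single h) hT

theorem total [Finite N] (hG : G.WellFormed) (v : List A) (e : PExp N A) :
    ∃ r, Parses G e v r := by
  induction hn : v.length using Nat.strong_induction_on generalizing v e with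
  | _ n ih =>
    subst hn
    have hs : ∀ u : List A, u.length < v.length → ∀ e, ∃ r, Parses G e u r :=
      fun u hu e => ih _ hu u e rfl
    refine total_expr v hs e ?_
    intro B hB
    clear hB
    induction B using (wf_left hG).induction with
    | _ B ihB =>
      obtain ⟨r, hr⟩ := total_expr v hs (G.rule B) ihB
      exact ⟨r, .nt hr⟩

end basic

/-! ### From PEGs to one-way DPPDAs -/

section toMachine
variable {N A : Type}

/-- States of the machine simulating a PEG. -/
inductive St (E : Type) : Type where
  | start : St E
  | acc : St E
  | ret : Bool → St E
  | eval : E → St E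

/-- Stack frames of the machine simulating a PEG. -/
inductive Fr (E : Type) : Type where
  | bot : Fr E
  | idf : Fr E
  | seqf : E → Fr E
  | chf : E → Fr E
  | notf : Fr E

instance {E : Type} [Finite E] : Finite (St E) := by
  let f : St E → Option (Option (Bool ⊕ E)) := fun s => match s with
    | .start => none
    | .acc => some none
    | .ret b => some (some (.inl b))
    | .eval e => some (some (.inr e))
  refine Finite.of_injective f ?_
  intro a b h
  cases a <;> cases b <;> simp_all [f]

instance {E : Type} [Finite E] : Finite (Fr E) := by
  let f : Fr E → Option (Option (Option (E ⊕ E))) := fun s => match s with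
    | .bot => none
    | .idf => some none
    | .notf => some (some none)
    | .seqf e => some (some (some (.inl e)))
    | .chf e => some (some (some (.inr e)))
  refine Finite.of_injective f ?_
  intro a b h
  cases a <;> cases b <;> simp_all [f]

/-- Result of returning successfully to a frame, moving the head by `d` if needed. -/
def onOk {E : Type} (rm : Bool) (d : Dir) : Fr E → Option (St E × List (Fr E) × Dir)
  | .bot => if rm then some (.acc, [], .down) else none
  | .idf => some (.ret true, [], d)
  | .seqf e => some (.eval e, [], d)
  | .chf _ => some (.ret true, [], d)
  | .notf => some (.ret false, [], .up)

/-- Result of returning with failure to a frame. -/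
def onFail {E : Type} : Fr E → Option (St E × List (Fr E) × Dir)
  | .bot => none
  | .idf => some (.ret false, [], .up)
  | .seqf _ => some (.ret false, [], .up)
  | .chf e => some (.eval e, [], .up)
  | .notf => some (.ret true, [], .up)

/-- Is the tape symbol the right marker? -/
def isRm : TSym A → Bool
  | .rmark => true
  | _ => false

open Classical in
/-- Evaluation moves. -/
noncomputable def evalTrans {E : Type} (G : PEG N A) (g : PExp N A → E) (e : PExp N A)
    (t : TSym A) (Z : Fr E) : Option (St E × List (Fr E) × Dir) :=
  match e with
  | .eps => onOk false .down Z
  | .term a => if t = .sym a then onOk false .right Z else onFail Z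
  | .nt B => some (.eval (g (G.rule B)), [.idf], .down)
  | .seq e1 e2 => some (.eval (g e1), [.seqf (g e2)], .down)
  | .choice e1 e2 => some (.eval (g e1), [.chf (g e2)], .down)
  | .not e1 => some (.eval (g e1), [.notf], .down)

/-- The transition function of the simulating machine. -/
noncomputable def mTrans {E : Type} (G : PEG N A) (f : E → PExp N A) (g : PExp N A → E) :
    St E → TSym A → Fr E → Option (St E × List (Fr E) × Dir)
  | .start, .lmark, _ => some (.eval (g (.nt G.start)), [.idf], .right)
  | .start, _, _ => none
  | .acc, _, _ => none
  | .ret true, t, Z => onOk (isRm t) .down Z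
  | .ret false, _, Z => onFail Z
  | .eval e, t, Z => evalTrans G g (f e) t Z

theorem onOk_cases {E : Type} {rm : Bool} {d : Dir} {Z : Fr E} {p β d'}
    (h : onOk rm d Z = some (p, β, d')) : β = [] ∧ (d' = d ∨ d' = .up ∨ d' = .down) := by
  cases Z <;> simp [onOk] at h <;> simp [← h]

theorem onFail_cases {E : Type} {Z : Fr E} {p β d'}
    (h : onFail Z = some (p, β, d')) : β = [] ∧ d' = .up := by
  cases Z <;> simp [onFail] at h <;> simp [← h]

theorem mTrans_cases {E : Type} {G : PEG N A} {f : E → PExp N A} {g : PExp N A → E}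
    {q a Z p β d} (h : mTrans G f g q a Z = some (p, β, d)) :
    (d = .up → β = []) ∧ d ≠ .left ∧ (d = .right → a ≠ .rmark) := by
  cases q with
  | start =>
    cases a <;> simp [mTrans] at h
    simp [← h]
  | acc => simp [mTrans] at h
  | ret b =>
    cases b
    · simp only [mTrans] at h
      simp [onFail_cases h]
    · simp only [mTrans] at h
      obtain ⟨rfl, h | h | h⟩ := onOk_cases h <;> simp [h]
  | eval e =>
    simp only [mTrans] at h
    cases hf : f e with
    | term b =>
      simp only [hf, evalTrans] at h
      split_ifs at h with hb
      · obtain ⟨rfl, h | h | h⟩ := onOk_cases h <;> simp [h, hb]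
      · simp [onFail_cases h]
    | eps =>
      simp only [hf, evalTrans] at h
      obtain ⟨rfl, h | h | h⟩ := onOk_cases h <;> simp [h]
    | nt B => simp [hf, evalTrans] at h; simp [← h]
    | seq e1 e2 => simp [hf, evalTrans] at h; simp [← h]
    | choice e1 e2 => simp [hf, evalTrans] at h; simp [← h]
    | not e1 => simp [hf, evalTrans] at h; simp [← h]

/-- The simulating machine. -/
noncomputable def mach {E : Type} (G : PEG N A) (f : E → PExp N A) (g : PExp N A → E) :
    DPPDA (St E) A (Fr E) where
  trans := mTrans G f g
  init := .start
  Z0 := .bot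
  final := fun s => match s with
    | .acc => true
    | _ => false
  up_pop := fun _ _ _ _ _ h => (mTrans_cases h).1 rfl
  no_left_lmark := fun _ _ _ _ h => (mTrans_cases h).2.1 rfl
  no_right_rmark := fun _ _ _ _ h => (mTrans_cases h).2.2 rfl rfl

/-- Position of a suffix. -/
def posOf (w v : List A) : ℕ := w.length + 1 - v.length

theorem tape_nil (w : List A) : tapeNth w (posOf w []) = .rmark := by
  simp [tapeNth, posOf]

theorem tape_cons {w : List A} {a : A} {s : List A} (h : (a :: s) <:+ w) :
    tapeNth w (posOf w (a :: s)) = .sym a := by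
  obtain ⟨t, rfl⟩ := h
  have h1 : (t ++ a :: s).length + 1 - (a :: s).length = t.length + 1 := by
    simp; omega
  rw [posOf, h1]
  simp [tapeNth]

theorem posOf_cons {w : List A} {a : A} {s : List A} (h : (a :: s) <:+ w) :
    posOf w (a :: s) + 1 = posOf w s := by
  have := h.length_le
  simp [posOf] at *
  omega

/-- Configuration reached after returning `r` to frame `Z`. -/
def after {E : Type} (w : List A) (r : Option (List A)) (Z : Fr E) (i : ℕ)
    (rest : List (Fr E × ℕ)) : Conf (St E) (Fr E) :=
  match r with
  | some v => match Z with
    | .bot => ⟨.acc, rest, 0⟩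
    | .idf => ⟨.ret true, rest, posOf w v⟩
    | .seqf e => ⟨.eval e, rest, posOf w v⟩
    | .chf _ => ⟨.ret true, rest, posOf w v⟩
    | .notf => ⟨.ret false, rest, i⟩
  | none => match Z with
    | .bot => ⟨.acc, rest, 0⟩
    | .idf => ⟨.ret false, rest, i⟩
    | .seqf _ => ⟨.ret false, rest, i⟩
    | .chf e => ⟨.eval e, rest, i⟩
    | .notf => ⟨.ret true, rest, i⟩

/-- The set of relevant subexpressions. -/
def subs : PExp N A → Set (PExp N A)
  | .eps => {.eps}
  | .term a => {.term a}
  | .nt B => {.nt B}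
  | .seq e1 e2 => {.seq e1 e2} ∪ (subs e1 ∪ subs e2)
  | .choice e1 e2 => {.choice e1 e2} ∪ (subs e1 ∪ subs e2)
  | .not e => {.not e} ∪ subs e

theorem subs_finite (e : PExp N A) : (subs e).Finite := by
  induction e with
  | eps => exact Set.finite_singleton _
  | term a => exact Set.finite_singleton _
  | nt B => exact Set.finite_singleton _
  | seq e1 e2 h1 h2 => exact (Set.finite_singleton _).union (h1.union h2)
  | choice e1 e2 h1 h2 => exact (Set.finite_singleton _).union (h1.union h2)
  | not e h => exact (Set.finite_singleton _).union h

theorem subs_self (e : PExp N A) : e ∈ subs e := by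
  cases e <;> simp [subs]

theorem subs_trans {e e' : PExp N A} (h : e' ∈ subs e) : subs e' ⊆ subs e := by
  induction e with
  | eps => simp [subs] at h; subst h; rfl
  | term a => simp [subs] at h; subst h; rfl
  | nt B => simp [subs] at h; subst h; rfl
  | seq e1 e2 h1 h2 =>
    rcases h with h | h | h
    · rw [Set.mem_singleton_iff] at h; subst h; rfl
    · exact fun x hx => Or.inr (Or.inl (h1 h hx))
    · exact fun x hx => Or.inr (Or.inr (h2 h hx))
  | choice e1 e2 h1 h2 =>
    rcases h with h | h | h
    · rw [Set.mem_singleton_iff] at h; subst h; rfl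
    · exact fun x hx => Or.inr (Or.inl (h1 h hx))
    · exact fun x hx => Or.inr (Or.inr (h2 h hx))
  | not e h1 =>
    rcases h with h | h
    · rw [Set.mem_singleton_iff] at h; subst h; rfl
    · exact fun x hx => Or.inr (h1 h hx)

/-- All expressions relevant for a grammar. -/
def Sub (G : PEG N A) : Set (PExp N A) := {.nt G.start} ∪ ⋃ B, subs (G.rule B)

theorem Sub_finite [Finite N] (G : PEG N A) : (Sub G).Finite :=
  (Set.finite_singleton _).union (Set.finite_iUnion fun _ => subs_finite _)

theorem Sub_closed {G : PEG N A} {e e' : PExp N A} (he : e ∈ Sub G) (h : e' ∈ subs e) :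
    e' ∈ Sub G := by
  rcases he with he | he
  · rw [Set.mem_singleton_iff] at he
    subst he
    simp [subs] at h
    subst h
    exact Or.inl rfl
  · rw [Set.mem_iUnion] at he
    obtain ⟨B, hB⟩ := he
    exact Or.inr (Set.mem_iUnion.2 ⟨B, subs_trans hB h⟩)

theorem sim {E : Type} {G : PEG N A} {f : E → PExp N A} {g : PExp N A → E}
    (hfg : ∀ e ∈ Sub G, f (g e) = e) (w : List A) {e : PExp N A} {v : List A}
    {r : Option (List A)} (h : Parses G e v r) (he : e ∈ Sub G) (hv : v <:+ w) :
    ∀ (Z : Fr E) (i : ℕ) (rest : List (Fr E × ℕ)), Z ≠ .bot →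
      (mach G f g).Reaches w ⟨.eval (g e), (Z, i) :: rest, posOf w v⟩ (after w r Z i rest) := by
  have hstep : ∀ {c c'}, (mach G f g).step w c = some c' → (mach G f g).Reaches w c c' :=
    fun h => Relation.ReflTransGen.single h
  induction h with
  | eps v =>
    intro Z i rest hZ
    apply hstep
    cases Z <;> simp [DPPDA.step, mach, mTrans, hfg _ he, evalTrans, onOk, after] at hZ ⊢
  | term_ok a s =>
    intro Z i rest hZ
    apply hstep
    have h1 := tape_cons hv
    have h2 := posOf_cons hv
    cases Z <;> simp [DPPDA.step, mach, mTrans, hfg _ he, evalTrans, onOk, after, h1, h2] at hZ ⊢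
  | @term_mismatch a b s hab =>
    intro Z i rest hZ
    apply hstep
    have h1 := tape_cons hv
    have hba : b ≠ a := fun h => hab h.symm
    cases Z <;> simp [DPPDA.step, mach, mTrans, hfg _ he, evalTrans, onFail, after, h1, hba] at hZ ⊢
  | term_nil a =>
    intro Z i rest hZ
    apply hstep
    have h1 := tape_nil w
    cases Z <;> simp [DPPDA.step, mach, mTrans, hfg _ he, evalTrans, onFail, after, h1] at hZ ⊢
  | @nt B v r _ ih =>
    intro Z i rest hZ
    have hr : G.rule B ∈ Sub G := Or.inr (Set.mem_iUnion.2 ⟨B, subs_self _⟩)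
    have h1 : (mach G f g).step w ⟨.eval (g (.nt B)), (Z, i) :: rest, posOf w v⟩ =
        some ⟨.eval (g (G.rule B)), (.idf, posOf w v) :: (Z, i) :: rest, posOf w v⟩ := by
      simp [DPPDA.step, mach, mTrans, hfg _ he, evalTrans]
    refine (hstep h1).trans ((ih hr hv _ _ _ (by simp)).trans (hstep ?_))
    cases r <;> cases Z <;> simp [DPPDA.step, mach, mTrans, onOk, onFail, after] at hZ ⊢
  | @seq_ok e1 e2 v v' r h1 _ ih1 ih2 =>
    intro Z i rest hZ
    have m1 : e1 ∈ Sub G := Sub_closed he (Or.inr (Or.inl (subs_self _)))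
    have m2 : e2 ∈ Sub G := Sub_closed he (Or.inr (Or.inr (subs_self _)))
    have h1' : (mach G f g).step w ⟨.eval (g (.seq e1 e2)), (Z, i) :: rest, posOf w v⟩ =
        some ⟨.eval (g e1), (.seqf (g e2), posOf w v) :: (Z, i) :: rest, posOf w v⟩ := by
      simp [DPPDA.step, mach, mTrans, hfg _ he, evalTrans]
    exact (hstep h1').trans ((ih1 m1 hv _ _ _ (by simp)).trans
      (ih2 m2 (((Parses.suffix_aux h1) _ rfl).1.trans hv) _ _ _ hZ))
  | @seq_fail e1 e2 v _ ih1 =>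
    intro Z i rest hZ
    have m1 : e1 ∈ Sub G := Sub_closed he (Or.inr (Or.inl (subs_self _)))
    have h1' : (mach G f g).step w ⟨.eval (g (.seq e1 e2)), (Z, i) :: rest, posOf w v⟩ =
        some ⟨.eval (g e1), (.seqf (g e2), posOf w v) :: (Z, i) :: rest, posOf w v⟩ := by
      simp [DPPDA.step, mach, mTrans, hfg _ he, evalTrans]
    refine (hstep h1').trans ((ih1 m1 hv _ _ _ (by simp)).trans (hstep ?_))
    cases Z <;> simp [DPPDA.step, mach, mTrans, onFail, after] at hZ ⊢
  | @choice_fst e1 e2 v v' _ ih1 =>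
    intro Z i rest hZ
    have m1 : e1 ∈ Sub G := Sub_closed he (Or.inr (Or.inl (subs_self _)))
    have h1' : (mach G f g).step w ⟨.eval (g (.choice e1 e2)), (Z, i) :: rest, posOf w v⟩ =
        some ⟨.eval (g e1), (.chf (g e2), posOf w v) :: (Z, i) :: rest, posOf w v⟩ := by
      simp [DPPDA.step, mach, mTrans, hfg _ he, evalTrans]
    refine (hstep h1').trans ((ih1 m1 hv _ _ _ (by simp)).trans (hstep ?_))
    cases Z <;> simp [DPPDA.step, mach, mTrans, onOk, after] at hZ ⊢
  | @choice_snd e1 e2 v r _ _ ih1 ih2 =>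
    intro Z i rest hZ
    have m1 : e1 ∈ Sub G := Sub_closed he (Or.inr (Or.inl (subs_self _)))
    have m2 : e2 ∈ Sub G := Sub_closed he (Or.inr (Or.inr (subs_self _)))
    have h1' : (mach G f g).step w ⟨.eval (g (.choice e1 e2)), (Z, i) :: rest, posOf w v⟩ =
        some ⟨.eval (g e1), (.chf (g e2), posOf w v) :: (Z, i) :: rest, posOf w v⟩ := by
      simp [DPPDA.step, mach, mTrans, hfg _ he, evalTrans]
    exact (hstep h1').trans ((ih1 m1 hv _ _ _ (by simp)).trans (ih2 m2 hv _ _ _ hZ))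
  | @not_succ e1 v _ ih1 =>
    intro Z i rest hZ
    have m1 : e1 ∈ Sub G := Sub_closed he (Or.inr (subs_self _))
    have h1' : (mach G f g).step w ⟨.eval (g (.not e1)), (Z, i) :: rest, posOf w v⟩ =
        some ⟨.eval (g e1), (.notf, posOf w v) :: (Z, i) :: rest, posOf w v⟩ := by
      simp [DPPDA.step, mach, mTrans, hfg _ he, evalTrans]
    refine (hstep h1').trans ((ih1 m1 hv _ _ _ (by simp)).trans (hstep ?_))
    cases Z <;> simp [DPPDA.step, mach, mTrans, onOk, after] at hZ ⊢
  | @not_fail e1 v v' _ ih1 =>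
    intro Z i rest hZ
    have m1 : e1 ∈ Sub G := Sub_closed he (Or.inr (subs_self _))
    have h1' : (mach G f g).step w ⟨.eval (g (.not e1)), (Z, i) :: rest, posOf w v⟩ =
        some ⟨.eval (g e1), (.notf, posOf w v) :: (Z, i) :: rest, posOf w v⟩ := by
      simp [DPPDA.step, mach, mTrans, hfg _ he, evalTrans]
    refine (hstep h1').trans ((ih1 m1 hv _ _ _ (by simp)).trans (hstep ?_))
    cases Z <;> simp [DPPDA.step, mach, mTrans, onFail, after] at hZ ⊢

theorem reaches_terminal {Q Γ : Type} (M : DPPDA Q A Γ) (w : List A) {c c1 c2 : Conf Q Γ}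
    (h1 : M.Reaches w c c1) (h2 : M.Reaches w c c2) (t1 : M.step w c1 = none)
    (t2 : M.step w c2 = none) : c1 = c2 := by
  induction h1 using Relation.ReflTransGen.head_induction_on with
  | refl =>
    cases Relation.ReflTransGen.cases_head h2 with
    | inl h => exact h
    | inr h => obtain ⟨d, hd, _⟩ := h; rw [t1] at hd; simp at hd
  | head ha _ ih =>
    cases Relation.ReflTransGen.cases_head h2 with
    | inl h => subst h; rw [t2] at ha; simp at ha
    | inr h =>
      obtain ⟨d, hd, h⟩ := h
      rw [ha] at hd
      simp only [Option.some.injEq] at hd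
      subst hd
      exact ih h

theorem pel_to_dppda {L : Set (List A)} (h : IsPEL L) : RecognizedByDPPDA L := by
  obtain ⟨N, hN, G, hG, rfl⟩ := h
  classical
  have hfin : Finite (Sub G) := (Sub_finite G)
  have hst : PExp.nt G.start ∈ Sub G := Or.inl rfl
  let f : Sub G → PExp N A := Subtype.val
  let g : PExp N A → Sub G := fun e => if h : e ∈ Sub G then ⟨e, h⟩ else ⟨_, hst⟩
  have hfg : ∀ e ∈ Sub G, f (g e) = e := fun e he => by simp [f, g, he]
  refine ⟨St (Sub G), Fr (Sub G), inferInstance, inferInstance, mach G f g,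
    fun _ _ _ _ _ h => (mTrans_cases h).2.1 rfl, fun w => ?_⟩
  obtain ⟨r, hr⟩ := total hG w (.nt G.start)
  have h0 : (mach G f g).Reaches w ⟨(mach G f g).init, [((mach G f g).Z0, 0)], 0⟩
      ⟨.eval (g (.nt G.start)), [(.idf, 1), (.bot, 0)], posOf w w⟩ := by
    apply Relation.ReflTransGen.single
    simp [DPPDA.step, mach, mTrans, tapeNth, posOf]
  have h1 := h0.trans (sim hfg w hr hst (List.suffix_refl w) .idf 1 [(.bot, 0)] (by simp))
  constructor
  · rintro ⟨qf, hqf, hacc⟩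
    cases r with
    | none =>
      have := reaches_terminal _ _ h1 hacc
        (by simp [DPPDA.step, mach, mTrans, onFail, after]) (by simp [DPPDA.step])
      simp [after] at this
    | some v =>
      cases v with
      | nil => exact hr
      | cons a s =>
        have hsuf := (Parses.suffix_aux hr _ rfl).1
        have := reaches_terminal _ _ h1 hacc
          (by simp [DPPDA.step, mach, mTrans, onOk, after, tape_cons hsuf, isRm])
          (by simp [DPPDA.step])
        simp [after] at this
  · intro hw
    have : r = some [] := Parses.det hr hw
    subst this
    refine ⟨.acc, rfl, h1.trans (Relation.ReflTransGen.single ?_)⟩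
    simp [DPPDA.step, mach, mTrans, onOk, after, tape_nil, isRm]
    simp [posOf]

end toMachine

/-! ### Abstract pushdown systems with single pushes and their big-step semantics -/

section abs

/-- Actions of an abstract system. -/
inductive Act (S Γ : Type) : Type where
  | stuck : Act S Γ
  | popDown : S → Act S Γ
  | popRight : S → Act S Γ
  | popUp : S → Act S Γ
  | pushDown : S → Γ → Act S Γ
  | pushRight : S → Γ → Act S Γ

/-- Big-step semantics: `Big δ w h s Z j p o` means that, started in `s` with `Z` on top and
head position `j`, the symbol `Z` is eventually popped in state `p`, with the head at `k`
if `o = some k`, or returning to the pointer stored with `Z` if `o = none`. -/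
inductive Big {S Γ A : Type} (δ : S → TSym A → Γ → Act S Γ) (w : List A) :
    ℕ → S → Γ → ℕ → S → Option ℕ → Prop where
  | popDown {s Z j p} : δ s (tapeNth w j) Z = .popDown p → Big δ w 0 s Z j p (some j)
  | popRight {s Z j p} : δ s (tapeNth w j) Z = .popRight p → Big δ w 0 s Z j p (some (j + 1))
  | popUp {s Z j p} : δ s (tapeNth w j) Z = .popUp p → Big δ w 0 s Z j p none
  | pushDown {s Z j s' X h₁ r o h₂ p o'} : δ s (tapeNth w j) Z = .pushDown s' X →
      Big δ w h₁ s' X j r o → Big δ w h₂ r Z (o.getD j) p o' →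
      Big δ w (h₁ + h₂ + 1) s Z j p o'
  | pushRight {s Z j s' X h₁ r o h₂ p o'} : δ s (tapeNth w j) Z = .pushRight s' X →
      Big δ w h₁ s' X (j + 1) r o → Big δ w h₂ r Z (o.getD (j + 1)) p o' →
      Big δ w (h₁ + h₂ + 1) s Z j p o'

variable {S Γ A : Type} {δ : S → TSym A → Γ → Act S Γ} {w : List A}

theorem Big.det {h s Z j p o h' p' o'} (H : Big δ w h s Z j p o) (H' : Big δ w h' s Z j p' o') :
    h = h' ∧ p = p' ∧ o = o' := by
  induction H generalizing h' p' o' with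
  | popDown e => cases H' <;> simp_all
  | popRight e => cases H' <;> simp_all
  | popUp e => cases H' <;> simp_all
  | pushDown e a b iha ihb =>
    cases H' with
    | pushDown e' a' b' =>
      rw [e] at e'
      cases e'
      obtain ⟨rfl, rfl, rfl⟩ := iha a'
      obtain ⟨rfl, rfl, rfl⟩ := ihb b'
      exact ⟨rfl, rfl, rfl⟩
    | _ => simp_all
  | pushRight e a b iha ihb =>
    cases H' with
    | pushRight e' a' b' =>
      rw [e] at e'
      cases e'
      obtain ⟨rfl, rfl, rfl⟩ := iha a'
      obtain ⟨rfl, rfl, rfl⟩ := ihb b'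
      exact ⟨rfl, rfl, rfl⟩
    | _ => simp_all

/-- No right moves on the right marker. -/
def NoRight (δ : S → TSym A → Γ → Act S Γ) : Prop :=
  ∀ s Z, (∀ p, δ s .rmark Z ≠ .popRight p) ∧ (∀ p X, δ s .rmark Z ≠ .pushRight p X)

theorem tape_ne_rmark {j : ℕ} (h : tapeNth w j ≠ .rmark) : j ≤ w.length := by
  by_contra hc
  apply h
  have h1 : j ≠ 0 := by omega
  have h2 : w.length ≤ j - 1 := by omega
  simp [tapeNth, h1, h2]

theorem Big.mono {h s Z j p o} (H : Big δ w h s Z j p o) : ∀ k, o = some k → j ≤ k := by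
  induction H with
  | popDown e => rintro k ⟨⟩; exact le_rfl
  | popRight e => rintro k ⟨⟩; omega
  | popUp e => simp
  | @pushDown s Z j s' X h₁ r o h₂ p o' e a b iha ihb =>
    intro k hk
    refine le_trans ?_ (ihb k hk)
    cases o with
    | none => exact le_rfl
    | some k' => exact iha k' rfl
  | @pushRight s Z j s' X h₁ r o h₂ p o' e a b iha ihb =>
    intro k hk
    refine le_trans ?_ (ihb k hk)
    cases o with
    | none => simp
    | some k' => have := iha k' rfl; simp; omega

theorem Big.bound (hR : NoRight δ) {h s Z j p o} (H : Big δ w h s Z j p o)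
    (hj : j ≤ w.length + 1) : ∀ k, o = some k → k ≤ w.length + 1 := by
  induction H with
  | popDown e => rintro k ⟨⟩; exact hj
  | popRight e =>
    rintro k ⟨⟩
    have := tape_ne_rmark (w := w) (fun hc => (hR _ _).1 _ (hc ▸ e))
    omega
  | popUp e => simp
  | @pushDown s Z j s' X h₁ r o h₂ p o' e a b iha ihb =>
    refine ihb ?_
    cases o with
    | none => exact hj
    | some k' => exact iha hj k' rfl
  | @pushRight s Z j s' X h₁ r o h₂ p o' e a b iha ihb =>
    have := tape_ne_rmark (w := w) (fun hc => (hR _ _).2 _ _ (hc ▸ e))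
    refine ihb ?_
    cases o with
    | none => simp; omega
    | some k' => exact iha (by omega) k' rfl

/-- Pairs whose evaluation at `j` terminates within size `h`. -/
def small (δ : S → TSym A → Γ → Act S Γ) (w : List A) (j h : ℕ) : Set (S × Γ) :=
  {x | ∃ h' ≤ h, ∃ p o, Big δ w h' x.1 x.2 j p o}

theorem small_lt [Finite S] [Finite Γ] {h s Z j p o} (H : Big δ w h s Z j p o) {h' : ℕ}
    (hh : h' < h) : (small δ w j h').ncard < (small δ w j h).ncard := by
  apply Set.ncard_lt_ncard _ (Set.toFinite _)
  refine ⟨fun x hx => ?_, fun hc => ?_⟩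
  · obtain ⟨h1, hle, hx⟩ := hx
    exact ⟨h1, by omega, hx⟩
  · have : (s, Z) ∈ small δ w j h := ⟨h, le_rfl, p, o, H⟩
    obtain ⟨h1, hle, p', o', H'⟩ := hc this
    have := (H.det H').1
    omega

theorem small_pos [Finite S] [Finite Γ] {h s Z j p o} (H : Big δ w h s Z j p o) :
    0 < (small δ w j h).ncard := by
  rw [Set.ncard_pos (Set.toFinite _)]
  exact ⟨(s, Z), h, le_rfl, p, o, H⟩

end abs

/-! ### Success semantics of total PEGs -/

section succ
variable {N A : Type} {G : PEG N A}

/-- Success of an expression. -/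
def Sc (G : PEG N A) (e : PExp N A) (v u : List A) : Prop := Parses G e v (some u)

theorem Sc.det {e : PExp N A} {v u u' : List A} (h : Sc G e v u) (h' : Sc G e v u') : u = u' := by
  simpa using Parses.det h h'

theorem sc_eps {v u : List A} : Sc G .eps v u ↔ u = v :=
  ⟨fun h => by cases h; rfl, fun h => h ▸ .eps _⟩

theorem sc_term {a : A} {v u : List A} : Sc G (.term a) v u ↔ v = a :: u :=
  ⟨fun h => by cases h; rfl, fun h => h ▸ .term_ok _ _⟩

theorem sc_nt {B : N} {v u : List A} : Sc G (.nt B) v u ↔ Sc G (G.rule B) v u :=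
  ⟨fun h => by cases h; assumption, fun h => .nt h⟩

theorem sc_seq {e1 e2 : PExp N A} {v u : List A} :
    Sc G (.seq e1 e2) v u ↔ ∃ x, Sc G e1 v x ∧ Sc G e2 x u :=
  ⟨fun h => by cases h with | seq_ok h1 h2 => exact ⟨_, h1, h2⟩,
    fun ⟨_, h1, h2⟩ => .seq_ok h1 h2⟩

variable (ht : ∀ e v, ∃ r, Parses G e v r)
include ht

theorem fail_iff {e : PExp N A} {v : List A} : Parses G e v none ↔ ¬ ∃ u, Sc G e v u := by
  constructor
  · rintro h ⟨u, hu⟩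
    have := Parses.det h hu
    simp at this
  · intro h
    obtain ⟨r, hr⟩ := ht e v
    cases r with
    | none => exact hr
    | some u => exact absurd ⟨u, hr⟩ h

theorem sc_not {e : PExp N A} {v u : List A} :
    Sc G (.not e) v u ↔ u = v ∧ ¬ ∃ u, Sc G e v u := by
  rw [← fail_iff ht]
  exact ⟨fun h => by cases h with | not_succ h => exact ⟨rfl, h⟩, 
    fun ⟨h1, h2⟩ => by subst h1; exact .not_succ h2⟩

theorem sc_and {e : PExp N A} {v u : List A} :
    Sc G (.not (.not e)) v u ↔ u = v ∧ ∃ u, Sc G e v u := by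
  rw [sc_not ht]
  simp only [sc_not ht]
  simp

theorem sc_choice {e1 e2 : PExp N A} {v u : List A} :
    Sc G (.choice e1 e2) v u ↔ Sc G e1 v u ∨ ((¬ ∃ u, Sc G e1 v u) ∧ Sc G e2 v u) := by
  rw [← fail_iff ht]
  constructor
  · intro h
    cases h with
    | choice_fst h => exact Or.inl h
    | choice_snd h1 h2 => exact Or.inr ⟨h1, h2⟩
  · rintro (h | ⟨h1, h2⟩)
    · exact .choice_fst h
    · exact .choice_snd h1 h2

/-- Iterated choice. -/
def bigCh (ff : PExp N A) (l : List (PExp N A)) : PExp N A := l.foldr .choice ff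

theorem bigCh_sound {ff : PExp N A} (hff : ∀ v u, ¬ Sc G ff v u) {l : List (PExp N A)}
    {v u : List A} (h : Sc G (bigCh ff l) v u) : ∃ e ∈ l, Sc G e v u := by
  induction l with
  | nil => exact absurd h (hff _ _)
  | cons e l ih =>
    rcases (sc_choice ht).1 h with h | ⟨_, h⟩
    · exact ⟨e, by simp, h⟩
    · obtain ⟨e', he', h'⟩ := ih h
      exact ⟨e', by simp [he'], h'⟩

theorem bigCh_complete {ff : PExp N A} {l : List (PExp N A)} {v u : List A}
    (hl : ∀ e ∈ l, ∀ u', Sc G e v u' → u' = u) (h : ∃ e ∈ l, Sc G e v u) :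
    Sc G (bigCh ff l) v u := by
  induction l with
  | nil => simp at h
  | cons e l ih =>
    refine (sc_choice ht).2 ?_
    by_cases he : ∃ u', Sc G e v u'
    · obtain ⟨u', hu'⟩ := he
      have := hl e (by simp) u' hu'
      subst this
      exact Or.inl hu'
    · refine Or.inr ⟨he, ih (fun e' he' => hl e' (by simp [he'])) ?_⟩
      obtain ⟨e', he', h'⟩ := h
      rcases List.mem_cons.1 he' with rfl | hm
      · exact absurd ⟨_, h'⟩ he
      · exact ⟨e', hm, h'⟩

end succ

/-! ### The grammar of an abstract system -/

section grammar
variable {S Γ A : Type}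

/-- Kinds of outcomes: popped without consumption, with consumption, returning to the pointer. -/
inductive Kd : Type where
  | zero | cons | up
deriving DecidableEq

/-- Nonterminals. -/
abbrev NT (S Γ : Type) : Type := Option (S × Γ × S × Bool)

/-- Suffix of the input at head position `j`. -/
def suf (w : List A) (j : ℕ) : List A := w.drop (j - 1)

/-- Positive lookahead for outcomes of kind `up`. -/
def wrap {N : Type} (o : Kd) (e : PExp N A) : PExp N A :=
  match o with
  | .up => .not (.not e)
  | _ => e

/-- The failing expression. -/
def ffail {N : Type} (a0 : A) : PExp N A := .seq (.not .eps) (.term a0)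

/-- Continuation after consumption. -/
def contE (a0 : A) (r : S) (Z : Γ) (p : S) (o : Kd) : PExp (NT S Γ) A :=
  match o with
  | .zero => ffail a0
  | .cons => .nt (some (r, Z, p, false))
  | .up => .nt (some (r, Z, p, true))

/-- Consumption of the tape symbol. -/
def tk (a0 : A) : TSym A → PExp (NT S Γ) A
  | .lmark => .eps
  | .rmark => ffail a0
  | .sym a => .term a

/-- Alternatives for a push moving right. -/
def altsR (a0 : A) (allS : List S) (t : TSym A) (s' : S) (X : Γ) (Z : Γ) (p : S) (o : Kd) :
    List (PExp (NT S Γ) A) :=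
  allS.flatMap fun r => [false, true].map fun m =>
    wrap o (.seq (.seq (tk a0 t) (.nt (some (s', X, r, m)))) (contE a0 r Z p o))

/-- Alternatives for a push that stays. -/
def altsD (a0 : A) (allS : List S) (F : S → Γ → S → Kd → PExp (NT S Γ) A)
    (s' : S) (X : Γ) (Z : Γ) (p : S) (o : Kd) : List (PExp (NT S Γ) A) :=
  allS.flatMap fun r => [.seq (F s' X r .zero) (F r Z p o), .seq (F s' X r .up) (F r Z p o),
    wrap o (.seq (F s' X r .cons) (contE a0 r Z p o))]

open Classical in
/-- Unrolled evaluation at a fixed head position. -/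
noncomputable def unr (δ : S → TSym A → Γ → Act S Γ) (a0 : A) (allS : List S) (t : TSym A) :
    ℕ → S → Γ → S → Kd → PExp (NT S Γ) A
  | 0 => fun _ _ _ _ => ffail a0
  | k + 1 => fun s Z p o =>
    match δ s t Z with
    | .stuck => ffail a0
    | .popDown p' => if p = p' ∧ o = .zero then .eps else ffail a0
    | .popRight p' => if p = p' ∧ o = .cons then tk a0 t else ffail a0
    | .popUp p' => if p = p' ∧ o = .up then .eps else ffail a0
    | .pushRight s' X => bigCh (ffail a0) (altsR a0 allS t s' X Z p o)
    | .pushDown s' X => bigCh (ffail a0) (altsD a0 allS (unr δ a0 allS t k) s' X Z p o)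

/-- Meaning of the kinds of outcomes. -/
def Rel (w : List A) (j : ℕ) (o : Kd) (res : Option ℕ) (u : List A) : Prop :=
  match o with
  | .zero => res = some j ∧ u = suf w j
  | .cons => ∃ k, j < k ∧ res = some k ∧ u = suf w k
  | .up => res = none ∧ u = suf w j

theorem Rel.det {w : List A} {j : ℕ} {o : Kd} {res : Option ℕ} {u u' : List A}
    (h : Rel w j o res u) (h' : Rel w j o res u') : u = u' := by
  cases o with
  | zero => exact h.2.trans h'.2.symm
  | up => exact h.2.trans h'.2.symm
  | cons =>
    obtain ⟨k, _, h1, h2⟩ := h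
    obtain ⟨k', _, h1', h2'⟩ := h'
    rw [h1] at h1'
    cases h1'
    exact h2.trans h2'.symm

/-- Meaning of the nonterminals. -/
def NRel (w : List A) (j : ℕ) (m : Bool) (res : Option ℕ) (u : List A) : Prop :=
  match m with
  | false => ∃ k, res = some k ∧ u = suf w k
  | true => res = none ∧ u = suf w j

theorem not_sc_ffail {N : Type} {G : PEG N A} (a0 : A) (v u : List A) : ¬ Sc G (ffail a0) v u := by
  intro h
  obtain ⟨x, h, _⟩ := sc_seq.1 h
  cases h with
  | not_succ h => cases h

variable {δ : S → TSym A → Γ → Act S Γ} {a0 : A} {allS : List S} {w : List A}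
  {G : PEG (NT S Γ) A}

theorem wrap_left (ht : ∀ e v, ∃ r, Parses G e v r) {o : Kd} {e d : PExp (NT S Γ) A}
    {v u : List A} (h : Sc G (wrap o (.seq e d)) v u) : ∃ x, Sc G e v x := by
  cases o with
  | zero => obtain ⟨x, hx, _⟩ := sc_seq.1 h; exact ⟨x, hx⟩
  | cons => obtain ⟨x, hx, _⟩ := sc_seq.1 h; exact ⟨x, hx⟩
  | up =>
    obtain ⟨_, y, h⟩ := (sc_and ht).1 h
    obtain ⟨x, hx, _⟩ := sc_seq.1 h; exact ⟨x, hx⟩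

/-- Specification of the nonterminals at a position. -/
def NSpec (δ : S → TSym A → Γ → Act S Γ) (G : PEG (NT S Γ) A) (w : List A) (j : ℕ) : Prop :=
  ∀ s Z p m u, Sc G (.nt (some (s, Z, p, m))) (suf w j) u ↔
    ∃ h res, Big δ w h s Z j p res ∧ NRel w j m res u

theorem wrap_cont (ht : ∀ e v, ∃ r, Parses G e v r) {j j' : ℕ} (hj : j < j')
    (hn : NSpec δ G w j') {e : PExp (NT S Γ) A} (he : Sc G e (suf w j) (suf w j'))
    {r : S} {Z : Γ} {p : S} {o : Kd} {u : List A} :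
    Sc G (wrap o (.seq e (contE a0 r Z p o))) (suf w j) u ↔
      ∃ h res, Big δ w h r Z j' p res ∧ Rel w j o res u := by
  have key : ∀ d u, Sc G (.seq e d) (suf w j) u ↔ Sc G d (suf w j') u := by
    intro d u
    rw [sc_seq]
    constructor
    · rintro ⟨x, hx, h⟩
      exact he.det hx ▸ h
    · exact fun h => ⟨_, he, h⟩
  cases o with
  | zero =>
    simp only [wrap, contE, key]
    constructor
    · exact fun h => absurd h (not_sc_ffail _ _ _)
    · rintro ⟨h, res, H, h1, _⟩
      have := H.mono _ h1
      omega
  | cons =>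
    simp only [wrap, contE, key]
    rw [hn]
    constructor
    · rintro ⟨h, res, H, k, h1, h2⟩
      have := H.mono _ h1
      exact ⟨h, res, H, k, by omega, h1, h2⟩
    · rintro ⟨h, res, H, k, _, h1, h2⟩
      exact ⟨h, res, H, k, h1, h2⟩
  | up =>
    simp only [wrap, contE, sc_and ht, key]
    simp only [hn r Z p true]
    constructor
    · rintro ⟨hu, _, h, res, H, h1, _⟩
      exact ⟨h, res, H, h1, hu⟩
    · rintro ⟨h, res, H, h1, h2⟩
      exact ⟨h2, _, h, res, H, h1, rfl⟩

/-- Specification of token consumption at a position. -/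
def TSpec (G : PEG (NT S Γ) A) (a0 : A) (w : List A) (j : ℕ) : Prop :=
  ∀ u, Sc G (tk a0 (tapeNth w j)) (suf w j) u ↔ u = suf w (j + 1) ∧ tapeNth w j ≠ .rmark

/-- The head position denoted by a nonterminal's result. -/
theorem NRel.pos {j : ℕ} {m : Bool} {res : Option ℕ} {u : List A} (h : NRel w j m res u) :
    u = suf w (res.getD j) := by
  cases m with
  | false => obtain ⟨k, rfl, h⟩ := h; exact h
  | true => obtain ⟨rfl, h⟩ := h; exact h

theorem exists_NRel (w : List A) (j : ℕ) (res : Option ℕ) :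
    ∃ m, NRel w j m res (suf w (res.getD j)) := by
  cases res with
  | none => exact ⟨true, rfl, rfl⟩
  | some k => exact ⟨false, k, rfl, rfl⟩

section at_pos
variable (ht : ∀ e v, ∃ r, Parses G e v r) (hR : NoRight δ) {j : ℕ} (hj : j ≤ w.length + 1)
  (hn : ∀ j', j < j' → j' ≤ w.length + 1 → NSpec δ G w j') (htk : TSpec G a0 w j)
include ht hR hj hn htk

theorem altsR_sound {s s' : S} {X Z : Γ} {p : S} {o : Kd}
    (hδ : δ s (tapeNth w j) Z = .pushRight s' X) :
    ∀ e ∈ altsR a0 allS (tapeNth w j) s' X Z p o, ∀ u, Sc G e (suf w j) u →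
      ∃ h res, Big δ w h s Z j p res ∧ Rel w j o res u := by
  intro e he u hu
  simp only [altsR, List.mem_flatMap, List.mem_map] at he
  obtain ⟨r, _, m, _, rfl⟩ := he
  obtain ⟨x, hx⟩ := wrap_left ht hu
  obtain ⟨y, hy, hyx⟩ := sc_seq.1 hx
  obtain ⟨rfl, hrm⟩ := (htk y).1 hy
  have hj1 : j + 1 ≤ w.length + 1 := by have := tape_ne_rmark hrm; omega
  obtain ⟨h1, res, H1, hrel⟩ := (hn (j + 1) (by omega) hj1 _ _ _ _ _).1 hyx
  have hpos := hrel.pos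
  subst hpos
  have hlt : j < res.getD (j + 1) := by
    cases res with
    | none => simp
    | some k => have := H1.mono k rfl; simp; omega
  have hle : res.getD (j + 1) ≤ w.length + 1 := by
    cases res with
    | none => exact hj1
    | some k => exact H1.bound hR hj1 k rfl
  obtain ⟨h2, res2, H2, hrel2⟩ := (wrap_cont ht hlt (hn _ hlt hle) hx).1 hu
  exact ⟨_, res2, .pushRight hδ H1 H2, hrel2⟩

theorem altsD_sound {F : S → Γ → S → Kd → PExp (NT S Γ) A}
    (hF : ∀ s Z p o u, Sc G (F s Z p o) (suf w j) u →
      ∃ h res, Big δ w h s Z j p res ∧ Rel w j o res u)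
    {s s' : S} {X Z : Γ} {p : S} {o : Kd}
    (hδ : δ s (tapeNth w j) Z = .pushDown s' X) :
    ∀ e ∈ altsD a0 allS F s' X Z p o, ∀ u, Sc G e (suf w j) u →
      ∃ h res, Big δ w h s Z j p res ∧ Rel w j o res u := by
  intro e he u hu
  simp only [altsD, List.mem_flatMap, List.mem_cons, List.not_mem_nil, or_false] at he
  obtain ⟨r, _, rfl | rfl | rfl⟩ := he
  · obtain ⟨x, hx, h2⟩ := sc_seq.1 hu
    obtain ⟨h1, res, H1, rfl, rfl⟩ := hF _ _ _ _ _ hx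
    obtain ⟨h2, res2, H2, hrel⟩ := hF _ _ _ _ _ h2
    exact ⟨_, res2, .pushDown hδ H1 H2, hrel⟩
  · obtain ⟨x, hx, h2⟩ := sc_seq.1 hu
    obtain ⟨h1, res, H1, rfl, rfl⟩ := hF _ _ _ _ _ hx
    obtain ⟨h2, res2, H2, hrel⟩ := hF _ _ _ _ _ h2
    exact ⟨_, res2, .pushDown hδ H1 H2, hrel⟩
  · obtain ⟨x, hx⟩ := wrap_left ht hu
    obtain ⟨h1, res, H1, k, hk, rfl, rfl⟩ := hF _ _ _ _ _ hx
    have hle : k ≤ w.length + 1 := H1.bound hR hj k rfl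
    obtain ⟨h2, res2, H2, hrel2⟩ := (wrap_cont ht hk (hn _ hk hle) hx).1 hu
    exact ⟨_, res2, .pushDown hδ H1 H2, hrel2⟩

theorem unr_sound (k : ℕ) : ∀ s Z p o u, Sc G (unr δ a0 allS (tapeNth w j) k s Z p o) (suf w j) u →
      ∃ h res, Big δ w h s Z j p res ∧ Rel w j o res u := by
  induction k with
  | zero => intro s Z p o u h; exact absurd h (not_sc_ffail _ _ _)
  | succ k ih =>
    intro s Z p o u h
    simp only [unr] at h
    split at h
    · exact absurd h (not_sc_ffail _ _ _)
    · rename_i p' hδ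
      split_ifs at h with hc
      · obtain ⟨rfl, rfl⟩ := hc
        exact ⟨_, _, .popDown hδ, rfl, sc_eps.1 h⟩
      · exact absurd h (not_sc_ffail _ _ _)
    · rename_i p' hδ
      split_ifs at h with hc
      · obtain ⟨rfl, rfl⟩ := hc
        exact ⟨_, _, .popRight hδ, j + 1, by omega, rfl, ((htk _).1 h).1⟩
      · exact absurd h (not_sc_ffail _ _ _)
    · rename_i p' hδ
      split_ifs at h with hc
      · obtain ⟨rfl, rfl⟩ := hc
        exact ⟨_, _, .popUp hδ, rfl, sc_eps.1 h⟩
      · exact absurd h (not_sc_ffail _ _ _)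
    · rename_i s' X hδ
      obtain ⟨e, he, hu⟩ := bigCh_sound ht (not_sc_ffail a0) h
      exact altsR_sound ht hR hj hn htk hδ e he u hu
    · rename_i s' X hδ
      obtain ⟨e, he, hu⟩ := bigCh_sound ht (not_sc_ffail a0) h
      exact altsD_sound ht hR hj hn htk ih hδ e he u hu

theorem unr_complete [Finite S] [Finite Γ] (hS : ∀ s, s ∈ allS) (k : ℕ) :
    ∀ h s Z p o res u, Big δ w h s Z j p res → (small δ w j h).ncard ≤ k → Rel w j o res u →
      Sc G (unr δ a0 allS (tapeNth w j) k s Z p o) (suf w j) u := by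
  induction k with
  | zero =>
    intro h s Z p o res u H hc _
    have := small_pos H
    omega
  | succ k ih =>
    intro h s Z p o res u H hc hrel
    have hdet : ∀ u', (∃ h res, Big δ w h s Z j p res ∧ Rel w j o res u') → u' = u := by
      rintro u' ⟨h', res', H', hrel'⟩
      obtain ⟨_, _, rfl⟩ := H.det H'
      exact hrel'.det hrel
    have hsm : ∀ h', h' < h → (small δ w j h').ncard ≤ k := by
      intro h' hh
      have := small_lt H hh
      omega
    have Horig := H
    cases H with
    | popDown hδ =>
      simp only [unr, hδ]
      cases o with
      | zero => simp [sc_eps, hrel.2]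
      | cons =>
        obtain ⟨k, hk, h1, _⟩ := hrel
        simp at h1; omega
      | up => have := hrel.1; simp at this
    | popRight hδ =>
      simp only [unr, hδ]
      cases o with
      | zero => have := hrel.1; simp at this
      | cons =>
        obtain ⟨k, hk, h1, rfl⟩ := hrel
        simp at h1
        subst h1
        simp only [and_self, if_true]
        exact (htk _).2 ⟨rfl, fun hc => (hR _ _).1 _ (hc ▸ hδ)⟩
      | up => have := hrel.1; simp at this
    | popUp hδ =>
      simp only [unr, hδ]
      cases o with
      | zero => have := hrel.1; simp at this
      | cons =>
        obtain ⟨k, hk, h1, _⟩ := hrel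
        simp at h1
      | up => simp [sc_eps, hrel.2]
    | @pushDown _ _ _ s' X h₁ r o1 h₂ _ _ hδ H1 H2 =>
      simp only [unr, hδ]
      have hsound := unr_sound (allS := allS) ht hR hj hn htk k
      refine bigCh_complete ht (fun e he u' hu' => hdet u'
        (altsD_sound ht hR hj hn htk hsound hδ e he u' hu')) ?_
      have mem : ∀ e ∈ [PExp.seq (unr δ a0 allS (tapeNth w j) k s' X r .zero)
            (unr δ a0 allS (tapeNth w j) k r Z p o),
          .seq (unr δ a0 allS (tapeNth w j) k s' X r .up) (unr δ a0 allS (tapeNth w j) k r Z p o),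
          wrap o (.seq (unr δ a0 allS (tapeNth w j) k s' X r .cons) (contE a0 r Z p o))],
          e ∈ altsD a0 allS (unr δ a0 allS (tapeNth w j) k) s' X Z p o := by
        intro e he
        exact List.mem_flatMap.2 ⟨r, hS r, he⟩
      have hs1 := hsm h₁ (by omega)
      have hs2 := hsm h₂ (by omega)
      cases o1 with
      | none =>
        refine ⟨_, mem _ (List.mem_cons_of_mem _ (List.mem_cons_self ..)),
          sc_seq.2 ⟨suf w j, ?_, ?_⟩⟩
        · exact ih _ _ _ _ _ _ _ H1 hs1 ⟨rfl, rfl⟩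
        · exact ih _ _ _ _ _ _ _ H2 hs2 hrel
      | some k1 =>
        have hm := H1.mono k1 rfl
        rcases Nat.eq_or_lt_of_le hm with rfl | hlt
        · refine ⟨_, mem _ (List.mem_cons_self ..), sc_seq.2 ⟨suf w j, ?_, ?_⟩⟩
          · exact ih _ _ _ _ _ _ _ H1 hs1 ⟨rfl, rfl⟩
          · exact ih _ _ _ _ _ _ _ H2 hs2 hrel
        · have hle := H1.bound hR hj k1 rfl
          refine ⟨_, mem (wrap o (.seq (unr δ a0 allS (tapeNth w j) k s' X r .cons)
            (contE a0 r Z p o))) (by simp), ?_⟩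
          have hx := ih _ _ _ _ .cons _ (suf w k1) H1 hs1 ⟨k1, hlt, rfl, rfl⟩
          exact (wrap_cont ht hlt (hn _ hlt hle) hx).2 ⟨_, _, H2, hrel⟩
    | @pushRight _ _ _ s' X h₁ r o1 h₂ _ _ hδ H1 H2 =>
      simp only [unr, hδ]
      refine bigCh_complete ht (fun e he u' hu' => hdet u'
        (altsR_sound ht hR hj hn htk hδ e he u' hu')) ?_
      have hrm : tapeNth w j ≠ .rmark := fun hc => (hR _ _).2 _ _ (hc ▸ hδ)
      have hj1 : j + 1 ≤ w.length + 1 := by have := tape_ne_rmark hrm; omega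
      have hlt : j < o1.getD (j + 1) := by
        cases o1 with
        | none => simp
        | some k => have := H1.mono k rfl; simp; omega
      have hle : o1.getD (j + 1) ≤ w.length + 1 := by
        cases o1 with
        | none => exact hj1
        | some k => exact H1.bound hR hj1 k rfl
      obtain ⟨m, hm⟩ := exists_NRel w (j + 1) o1
      refine ⟨wrap o (.seq (.seq (tk a0 (tapeNth w j)) (.nt (some (s', X, r, m))))
        (contE a0 r Z p o)), ?_, ?_⟩
      · refine List.mem_flatMap.2 ⟨r, hS r, List.mem_map.2 ⟨m, ?_, rfl⟩⟩
        cases m <;> simp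
      · have hx : Sc G (.seq (tk a0 (tapeNth w j)) (.nt (some (s', X, r, m)))) (suf w j)
            (suf w (o1.getD (j + 1))) :=
          sc_seq.2 ⟨_, (htk _).2 ⟨rfl, hrm⟩, (hn _ (by omega) hj1 _ _ _ _ _).2 ⟨_, _, H1, hm⟩⟩
        exact (wrap_cont ht hlt (hn _ hlt hle) hx).2 ⟨_, _, H2, hrel⟩

end at_pos
end grammar

section grammar2
variable {S Γ A : Type}

/-- Lookahead for a tape symbol. -/
def look (a0 : A) (allA : List A) : TSym A → PExp (NT S Γ) A
  | .lmark => ffail a0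
  | .rmark => .not (bigCh (ffail a0) (allA.map .term))
  | .sym a => .not (.not (.term a))

/-- Kinds of outcomes for a nonterminal. -/
def kinds : Bool → List Kd
  | false => [.zero, .cons]
  | true => [.up]

/-- Alternatives of a rule. -/
noncomputable def ruleAlts (δ : S → TSym A → Γ → Act S Γ) (a0 : A) (allS : List S) (allA : List A)
    (K : ℕ) (s : S) (Z : Γ) (p : S) (m : Bool) : List (PExp (NT S Γ) A) :=
  (TSym.rmark :: allA.map TSym.sym).flatMap fun t =>
    (kinds m).map fun o => .seq (look a0 allA t) (unr δ a0 allS t K s Z p o)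

/-- The grammar of an abstract system. -/
noncomputable def gr (δ : S → TSym A → Γ → Act S Γ) (a0 : A) (allS : List S) (allA : List A)
    (K : ℕ) (init : S) (Z0 : Γ) (finS : List S) : PEG (NT S Γ) A where
  start := none
  rule := fun B => match B with
    | none => bigCh (ffail a0) (finS.map fun p => unr δ a0 allS .lmark K init Z0 p .cons)
    | some (s, Z, p, m) => bigCh (ffail a0) (ruleAlts δ a0 allS allA K s Z p m)

theorem ffail_left {N : Type} (a0 : A) : (ffail a0 : PExp N A).leftNts = ∅ := by
  simp [ffail, PExp.leftNts]

theorem ffail_me {N : Type} (a0 : A) : (ffail a0 : PExp N A).maybeEmpty = false := by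
  simp [ffail, PExp.maybeEmpty]

theorem bigCh_left {N : Type} (a0 : A) {B : N} {l : List (PExp N A)}
    (h : B ∈ (bigCh (ffail a0) l).leftNts) : ∃ e ∈ l, B ∈ e.leftNts := by
  induction l with
  | nil => simp [bigCh, ffail_left] at h
  | cons e l ih =>
    rcases h with h | h
    · exact ⟨e, by simp, h⟩
    · obtain ⟨e', he', h'⟩ := ih h
      exact ⟨e', by simp [he'], h'⟩

theorem bigCh_me {N : Type} (a0 : A) {l : List (PExp N A)}
    (h : ∀ e ∈ l, e.maybeEmpty = false) : (bigCh (ffail a0) l).maybeEmpty = false := by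
  induction l with
  | nil => exact ffail_me a0
  | cons e l ih =>
    have h1 := h e (by simp)
    have h2 := ih (fun e' he' => h e' (by simp [he']))
    simp only [bigCh, List.foldr_cons, PExp.maybeEmpty, Bool.or_eq_false_iff]
    exact ⟨h1, h2⟩

theorem wrap_leftNts {N : Type} (o : Kd) (e : PExp N A) : (wrap o e).leftNts = e.leftNts := by
  cases o <;> rfl

theorem wrap_me {N : Type} {o : Kd} (ho : o = .cons) (e : PExp N A) :
    (wrap o e).maybeEmpty = e.maybeEmpty := by
  subst ho; rfl

theorem seq_left_sub {N : Type} {B : N} {e1 e2 : PExp N A} (h : B ∈ (PExp.seq e1 e2).leftNts) :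
    B ∈ e1.leftNts ∨ (e1.maybeEmpty = true ∧ B ∈ e2.leftNts) := by
  rcases h with h | h
  · exact Or.inl h
  · split_ifs at h with hc
    · exact Or.inr ⟨hc, h⟩
    · exact absurd h (Set.notMem_empty _)

theorem contE_none (a0 : A) (r : S) (Z : Γ) (p : S) (o : Kd) :
    none ∉ (contE a0 r Z p o).leftNts := by
  cases o <;> simp [contE, ffail_left, PExp.leftNts]

theorem tk_left (a0 : A) (t : TSym A) : (tk a0 t : PExp (NT S Γ) A).leftNts = ∅ := by
  cases t <;> simp [tk, ffail_left, PExp.leftNts]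

theorem tk_me (a0 : A) {t : TSym A} (h : t ≠ .lmark) :
    (tk a0 t : PExp (NT S Γ) A).maybeEmpty = false := by
  cases t <;> simp [tk, ffail_me, PExp.maybeEmpty] at h ⊢

theorem unr_me (δ : S → TSym A → Γ → Act S Γ) (a0 : A) (allS : List S) {t : TSym A}
    (h : t ≠ .lmark) (k : ℕ) : ∀ s Z p,
      (unr δ a0 allS t k s Z p .cons).maybeEmpty = false := by
  induction k with
  | zero => intros; exact ffail_me a0
  | succ k ih =>
    intro s Z p
    simp only [unr]
    split
    · exact ffail_me a0
    · simp [ffail_me]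
    · split_ifs
      · exact tk_me a0 h
      · exact ffail_me a0
    · simp [ffail_me]
    · refine bigCh_me a0 ?_
      intro e he
      simp only [altsR, List.mem_flatMap, List.mem_map] at he
      obtain ⟨r, _, m, _, rfl⟩ := he
      simp [wrap, PExp.maybeEmpty, tk_me a0 h]
    · refine bigCh_me a0 ?_
      intro e he
      simp only [altsD, List.mem_flatMap, List.mem_cons, List.not_mem_nil, or_false] at he
      obtain ⟨r, _, rfl | rfl | rfl⟩ := he <;> simp [wrap, PExp.maybeEmpty, ih]

theorem unr_left (δ : S → TSym A → Γ → Act S Γ) (a0 : A) (allS : List S) {t : TSym A} (B : NT S Γ)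
    (h : t ≠ .lmark ∨ B = none) (k : ℕ) : ∀ s Z p o,
      B ∉ (unr δ a0 allS t k s Z p o).leftNts := by
  induction k with
  | zero => intros; simp [unr, ffail_left]
  | succ k ih =>
    intro s Z p o
    simp only [unr]
    split
    · simp [ffail_left]
    · split_ifs <;> simp [ffail_left, PExp.leftNts]
    · split_ifs <;> simp [ffail_left, tk_left]
    · split_ifs <;> simp [ffail_left, PExp.leftNts]
    · intro hB
      obtain ⟨e, he, hB⟩ := bigCh_left a0 hB
      simp only [altsR, List.mem_flatMap, List.mem_map] at he
      obtain ⟨r, _, m, _, rfl⟩ := he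
      rw [wrap_leftNts] at hB
      rcases seq_left_sub hB with hB | ⟨hm, hB⟩
      · rcases seq_left_sub hB with hB | ⟨hm, hB⟩
        · simp [tk_left] at hB
        · rcases h with h | h
          · simp [tk_me a0 h] at hm
          · subst h; simp [PExp.leftNts] at hB
      · rcases h with h | h
        · simp [tk_me a0 h, PExp.maybeEmpty] at hm
        · subst h; exact contE_none _ _ _ _ _ hB
    · intro hB
      obtain ⟨e, he, hB⟩ := bigCh_left a0 hB
      simp only [altsD, List.mem_flatMap, List.mem_cons, List.not_mem_nil, or_false] at he
      obtain ⟨r, _, rfl | rfl | rfl⟩ := he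
      · rcases seq_left_sub hB with hB | ⟨hm, hB⟩ <;> exact ih _ _ _ _ hB
      · rcases seq_left_sub hB with hB | ⟨hm, hB⟩ <;> exact ih _ _ _ _ hB
      · rw [wrap_leftNts] at hB
        rcases seq_left_sub hB with hB | ⟨hm, hB⟩
        · exact ih _ _ _ _ hB
        · rcases h with h | h
          · simp [unr_me δ a0 allS h] at hm
          · subst h; exact contE_none _ _ _ _ _ hB

theorem look_left (a0 : A) (allA : List A) (t : TSym A) (B : NT S Γ) :
    B ∉ (look a0 allA t : PExp (NT S Γ) A).leftNts := by
  cases t with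
  | lmark => simp [look, ffail_left]
  | sym a => simp [look, PExp.leftNts]
  | rmark =>
    intro h
    obtain ⟨e, he, hB⟩ := bigCh_left a0 (show B ∈ (bigCh (ffail a0) (allA.map .term)).leftNts from h)
    simp only [List.mem_map] at he
    obtain ⟨a, _, rfl⟩ := he
    simp [PExp.leftNts] at hB

theorem gr_wf (δ : S → TSym A → Γ → Act S Γ) (a0 : A) (allS : List S) (allA : List A)
    (K : ℕ) (init : S) (Z0 : Γ) (finS : List S) :
    (gr δ a0 allS allA K init Z0 finS).WellFormed := by
  have h1 : ∀ x B, B ∉ ((gr δ a0 allS allA K init Z0 finS).rule (some x)).leftNts := by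
    rintro ⟨s, Z, p, m⟩ B hB
    obtain ⟨e, he, hB⟩ := bigCh_left a0 hB
    simp only [ruleAlts, List.mem_flatMap, List.mem_map] at he
    obtain ⟨t, ht, o, _, rfl⟩ := he
    have htl : t ≠ .lmark := by
      rintro rfl
      simp at ht
    rcases seq_left_sub hB with hB | ⟨hm, hB⟩
    · exact look_left _ _ _ _ hB
    · exact unr_left δ a0 allS B (Or.inl htl) _ _ _ _ _ hB
  have h2 : none ∉ ((gr δ a0 allS allA K init Z0 finS).rule none).leftNts := by
    intro hB
    obtain ⟨e, he, hB⟩ := bigCh_left a0 hB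
    simp only [List.mem_map] at he
    obtain ⟨p, _, rfl⟩ := he
    exact unr_left δ a0 allS none (Or.inr rfl) _ _ _ _ _ hB
  intro B hB
  cases B with
  | some x =>
    obtain ⟨c, hc, _⟩ := Relation.TransGen.head'_iff.1 hB
    exact h1 x c hc
  | none =>
    obtain ⟨c, _, hc⟩ := Relation.TransGen.tail'_iff.1 hB
    cases c with
    | none => exact h2 hc
    | some x => exact h1 x _ hc

theorem tape_suf {w : List A} {j : ℕ} (hj : 1 ≤ j) :
    tapeNth w j = match suf w j with
      | [] => .rmark
      | a :: _ => .sym a := by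
  have h0 : j ≠ 0 := by omega
  have : w[j - 1]? = (suf w j).head? := by simp [suf]
  simp only [tapeNth, h0, if_false, this]
  cases suf w j <;> rfl

theorem suf_succ {w : List A} {j : ℕ} (hj : 1 ≤ j) : suf w (j + 1) = (suf w j).tail := by
  simp only [suf, List.tail_drop]
  congr 1
  omega

theorem tspec (G : PEG (NT S Γ) A) (a0 : A) (w : List A) (j : ℕ) : TSpec G a0 w j := by
  intro u
  rcases Nat.eq_zero_or_pos j with rfl | hj
  · have : tapeNth w 0 = .lmark := by simp [tapeNth]
    rw [this]
    simp [tk, sc_eps, suf]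
  · rw [tape_suf hj, suf_succ hj]
    cases hs : suf w j with
    | nil => simp [tk, not_sc_ffail]
    | cons a s => simp [tk, sc_term, eq_comm]

variable {δ : S → TSym A → Γ → Act S Γ} {a0 : A} {allS : List S} {allA : List A} {w : List A}

theorem sc_look {G : PEG (NT S Γ) A} (ht : ∀ e v, ∃ r, Parses G e v r) (hA : ∀ a, a ∈ allA)
    {j : ℕ} (hj : 1 ≤ j) {t : TSym A} (htl : t ≠ .lmark) {u : List A} :
    Sc G (look a0 allA t) (suf w j) u ↔ u = suf w j ∧ t = tapeNth w j := by
  rw [tape_suf hj]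
  cases t with
  | lmark => exact absurd rfl htl
  | sym a =>
    simp only [look, sc_and ht, sc_term]
    cases suf w j with
    | nil => simp
    | cons b s => simp [eq_comm]
  | rmark =>
    simp only [look, sc_not ht]
    refine and_congr_right fun _ => ?_
    cases hs : suf w j with
    | nil =>
      simp only [iff_true]
      rintro ⟨u, hu⟩
      obtain ⟨e, he, h⟩ := bigCh_sound ht (not_sc_ffail a0) hu
      simp only [List.mem_map] at he
      obtain ⟨a, _, rfl⟩ := he
      simp [sc_term] at h
    | cons b s =>
      simp only [reduceCtorEq, iff_false, not_not]
      refine ⟨s, bigCh_complete ht ?_ ⟨.term b, List.mem_map.2 ⟨b, hA b, rfl⟩, sc_term.2 rfl⟩⟩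
      intro e he u' hu'
      simp only [List.mem_map] at he
      obtain ⟨a, _, rfl⟩ := he
      have := sc_term.1 hu'
      simp at this
      exact this.2.symm

theorem nspec [Finite S] [Finite Γ] (hR : NoRight δ) (hS : ∀ s, s ∈ allS) (hA : ∀ a, a ∈ allA)
    {K : ℕ} (hK : Nat.card (S × Γ) ≤ K) {init : S} {Z0 : Γ} {finS : List S} (n : ℕ) :
    ∀ j, 1 ≤ j → j ≤ w.length + 1 → w.length + 1 - j = n →
      NSpec δ (gr δ a0 allS allA K init Z0 finS) w j := by
  have ht : ∀ e v, ∃ r, Parses (gr δ a0 allS allA K init Z0 finS) e v r :=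
    have : Finite Γ := inferInstance
    fun e v => total (gr_wf δ a0 allS allA K init Z0 finS) v e
  induction n using Nat.strong_induction_on with
  | _ n ih =>
    intro j hj1 hj hjn
    have hn : ∀ j', j < j' → j' ≤ w.length + 1 →
        NSpec δ (gr δ a0 allS allA K init Z0 finS) w j' :=
      fun j' h1 h2 => ih _ (by omega) j' (by omega) h2 rfl
    have htk := tspec (gr δ a0 allS allA K init Z0 finS) a0 w j
    have alts : ∀ s Z p m, ∀ e ∈ ruleAlts δ a0 allS allA K s Z p m, ∀ u,
        Sc (gr δ a0 allS allA K init Z0 finS) e (suf w j) u →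
          ∃ h res, Big δ w h s Z j p res ∧ NRel w j m res u := by
      intro s Z p m e he u hu
      simp only [ruleAlts, List.mem_flatMap, List.mem_map] at he
      obtain ⟨t, hts, o, ho, rfl⟩ := he
      have htl : t ≠ .lmark := by
        rintro rfl
        simp at hts
      obtain ⟨x, hx, hu⟩ := sc_seq.1 hu
      obtain ⟨rfl, rfl⟩ := (sc_look ht hA hj1 htl).1 hx
      obtain ⟨h, res, H, hrel⟩ := unr_sound ht hR hj hn htk K _ _ _ _ _ hu
      refine ⟨h, res, H, ?_⟩
      cases m with
      | true =>
        simp [kinds] at ho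
        subst ho
        exact hrel
      | false =>
        simp [kinds] at ho
        rcases ho with rfl | rfl
        · exact ⟨j, hrel⟩
        · obtain ⟨k, _, h1, h2⟩ := hrel
          exact ⟨k, h1, h2⟩
    intro s Z p m u
    rw [sc_nt]
    constructor
    · intro h
      obtain ⟨e, he, hu⟩ := bigCh_sound ht (not_sc_ffail a0) h
      exact alts s Z p m e he u hu
    · rintro ⟨h, res, H, hrel⟩
      refine bigCh_complete ht ?_ ?_
      · intro e he u' hu'
        obtain ⟨h', res', H', hrel'⟩ := alts s Z p m e he u' hu'
        obtain ⟨_, _, rfl⟩ := H.det H'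
        rw [hrel.pos, hrel'.pos]
      · have hcard : (small δ w j h).ncard ≤ K := by
          refine le_trans ?_ hK
          rw [← Set.ncard_univ]
          exact Set.ncard_le_ncard (Set.subset_univ _) (Set.toFinite _)
        have hex : ∃ o ∈ kinds m, Rel w j o res u := by
          cases m with
          | true => exact ⟨.up, by simp [kinds], hrel⟩
          | false =>
            obtain ⟨k, rfl, rfl⟩ := hrel
            rcases Nat.eq_or_lt_of_le (H.mono k rfl) with rfl | hlt
            · exact ⟨.zero, by simp [kinds], rfl, rfl⟩
            · exact ⟨.cons, by simp [kinds], k, hlt, rfl, rfl⟩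
        obtain ⟨o, ho, hrel'⟩ := hex
        have htl : tapeNth w j ≠ .lmark := by
          rw [tape_suf hj1]
          cases suf w j <;> simp
        refine ⟨.seq (look a0 allA (tapeNth w j)) (unr δ a0 allS (tapeNth w j) K s Z p o), ?_, ?_⟩
        · refine List.mem_flatMap.2 ⟨tapeNth w j, ?_, List.mem_map.2 ⟨o, ho, rfl⟩⟩
          cases htp : tapeNth w j with
          | lmark => exact absurd htp htl
          | rmark => simp
          | sym a => simp [hA]
        · exact sc_seq.2 ⟨suf w j, (sc_look ht hA hj1 htl).2 ⟨rfl, rfl⟩,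
            unr_complete ht hR hj hn htk hS K _ _ _ _ _ _ _ H hcard hrel'⟩

theorem gr_correct [Finite S] [Finite Γ] (hR : NoRight δ) (hS : ∀ s, s ∈ allS)
    (hA : ∀ a, a ∈ allA)
    {K : ℕ} (hK : Nat.card (S × Γ) ≤ K) {init : S} {Z0 : Γ} {finS : List S} :
    w ∈ (gr δ a0 allS allA K init Z0 finS).Lang ↔
      ∃ p ∈ finS, ∃ h, Big δ w h init Z0 0 p (some (w.length + 1)) := by
  have ht : ∀ e v, ∃ r, Parses (gr δ a0 allS allA K init Z0 finS) e v r :=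
    fun e v => total (gr_wf δ a0 allS allA K init Z0 finS) v e
  have hn : ∀ j', 0 < j' → j' ≤ w.length + 1 →
      NSpec δ (gr δ a0 allS allA K init Z0 finS) w j' :=
    fun j' h1 h2 => nspec hR hS hA hK _ j' h1 h2 rfl
  have htk := tspec (gr δ a0 allS allA K init Z0 finS) a0 w 0
  have hs0 : suf w 0 = w := by simp [suf]
  have ht0 : tapeNth w 0 = .lmark := by simp [tapeNth]
  have sound : ∀ p u, Sc (gr δ a0 allS allA K init Z0 finS)
      (unr δ a0 allS .lmark K init Z0 p .cons) w u →
      ∃ h k, Big δ w h init Z0 0 p (some k) ∧ 0 < k ∧ k ≤ w.length + 1 ∧ u = suf w k := by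
    intro p u hu
    obtain ⟨h, res, H, k, hk, rfl, rfl⟩ := unr_sound ht hR (Nat.zero_le _) hn htk K init Z0 p .cons u
      (by rw [hs0, ht0]; exact hu)
    exact ⟨h, k, H, hk, H.bound hR (Nat.zero_le _) k rfl, rfl⟩
  have hlang : w ∈ (gr δ a0 allS allA K init Z0 finS).Lang ↔
    Sc (gr δ a0 allS allA K init Z0 finS) (bigCh (ffail a0)
      (finS.map fun p => unr δ a0 allS .lmark K init Z0 p .cons)) w [] := sc_nt
  rw [hlang]
  constructor
  · intro h
    obtain ⟨e, he, hu⟩ := bigCh_sound ht (not_sc_ffail a0) h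
    simp only [List.mem_map] at he
    obtain ⟨p, hp, rfl⟩ := he
    obtain ⟨h, k, H, hk, hk2, hsuf⟩ := sound p _ hu
    have : k = w.length + 1 := by
      have := congrArg List.length hsuf
      simp [suf] at this
      omega
    subst this
    exact ⟨p, hp, h, H⟩
  · rintro ⟨p, hp, h, H⟩
    have hlast : suf w (w.length + 1) = [] := by simp [suf]
    refine bigCh_complete ht ?_ ⟨_, List.mem_map.2 ⟨p, hp, rfl⟩, ?_⟩
    · intro e he u' hu'
      simp only [List.mem_map] at he
      obtain ⟨p', hp', rfl⟩ := he
      obtain ⟨h', k, H', hk, hk2, rfl⟩ := sound p' _ hu'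
      obtain ⟨_, _, h3⟩ := H.det H'
      cases h3
      exact hlast
    · have hcard : (small δ w 0 h).ncard ≤ K := by
        refine le_trans ?_ hK
        rw [← Set.ncard_univ]
        exact Set.ncard_le_ncard (Set.subset_univ _) (Set.toFinite _)
      have := unr_complete ht hR (Nat.zero_le _) hn htk hS K h init Z0 p .cons _ [] H hcard
        ⟨_, by omega, rfl, hlast.symm⟩
      rw [hs0, ht0] at this
      exact this

end grammar2

/-! ### From one-way DPPDAs to abstract systems -/

section fromMachine
variable {Q A Γ : Type}

/-- States with a bounded list of pending pushes. -/
abbrev PS (Q Γ : Type) (m : ℕ) : Type := Q × {l : List Γ // l.length ≤ m}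

/-- Truncation to a bounded list. -/
def mkB (m : ℕ) (l : List Γ) : {l : List Γ // l.length ≤ m} := ⟨l.take m, by simp⟩

theorem mkB_val {m : ℕ} {l : List Γ} (h : l.length ≤ m) : (mkB m l).1 = l :=
  List.take_of_length_le h

/-- The abstract system of a machine. -/
def dM (M : DPPDA Q A Γ) (m : ℕ) (s : PS Q Γ m) (t : TSym A) (Z : Γ) : Act (PS Q Γ m) Γ :=
  match s.2.1.getLast? with
  | some X => .pushDown (s.1, mkB m s.2.1.dropLast) X
  | none => match M.trans s.1 t Z with
    | none => .stuck
    | some (p, β, d) => match β.getLast?, d with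
      | none, .down => .popDown (p, mkB m [])
      | none, .right => .popRight (p, mkB m [])
      | none, .up => .popUp (p, mkB m [])
      | none, .left => .stuck
      | some X, .down => .pushDown (p, mkB m β.dropLast) X
      | some X, .right => .pushRight (p, mkB m β.dropLast) X
      | some _, .up => .stuck
      | some _, .left => .stuck

/-- Concrete configuration. -/
def cfg {m : ℕ} (s : PS Q Γ m) (j : ℕ) (st : List (Γ × ℕ)) : Conf Q Γ :=
  ⟨s.1, s.2.1.map (fun Y => (Y, j)) ++ st, j⟩

/-- Correspondence of abstract actions and machine moves. -/
def StepSpec (M : DPPDA Q A Γ) (w : List A) {m : ℕ} (s : PS Q Γ m) (j : ℕ) (Z : Γ) (i : ℕ)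
    (rest : List (Γ × ℕ)) : Act (PS Q Γ m) Γ → Prop
  | .stuck => M.step w (cfg s j ((Z, i) :: rest)) = none
  | .popDown p => M.step w (cfg s j ((Z, i) :: rest)) = some (cfg p j rest) ∧ p.2.1 = []
  | .popRight p => M.step w (cfg s j ((Z, i) :: rest)) = some (cfg p (j + 1) rest) ∧ p.2.1 = []
  | .popUp p => M.step w (cfg s j ((Z, i) :: rest)) = some (cfg p i rest) ∧ p.2.1 = []
  | .pushDown s' X =>
      M.step w (cfg s j ((Z, i) :: rest)) = some (cfg s' j ((X, j) :: (Z, i) :: rest)) ∨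
      (cfg s j ((Z, i) :: rest) = cfg s' j ((X, j) :: (Z, i) :: rest) ∧
        s'.2.1.length < s.2.1.length)
  | .pushRight s' X =>
      M.step w (cfg s j ((Z, i) :: rest)) = some (cfg s' (j + 1) ((X, j + 1) :: (Z, i) :: rest))

theorem stepSpec {M : DPPDA Q A Γ} (hM : M.OneWay) {m : ℕ}
    (hm : ∀ q t Z p β d, M.trans q t Z = some (p, β, d) → β.length ≤ m) (w : List A)
    (s : PS Q Γ m) (j : ℕ) (Z : Γ) (i : ℕ) (rest : List (Γ × ℕ)) :
    StepSpec M w s j Z i rest (dM M m s (tapeNth w j) Z) := by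
  obtain ⟨q, l, hl⟩ := s
  rcases List.eq_nil_or_concat l with rfl | ⟨l', X, rfl⟩
  · have hnil : (mkB m ([] : List Γ)).1 = [] := by simp [mkB]
    cases htr : M.trans q (tapeNth w j) Z with
    | none => simp [dM, htr, StepSpec, DPPDA.step, cfg]
    | some x =>
      obtain ⟨p, β, d⟩ := x
      have hb := hm _ _ _ _ _ _ htr
      rcases List.eq_nil_or_concat β with rfl | ⟨β', X, rfl⟩
      · cases d with
        | left => exact absurd htr (hM _ _ _ _ _)
        | down => simp [dM, htr, StepSpec, DPPDA.step, cfg, hnil]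
        | up => simp [dM, htr, StepSpec, DPPDA.step, cfg, hnil]
        | right => simp [dM, htr, StepSpec, DPPDA.step, cfg, hnil]
      · have hb' : (mkB m β').1 = β' := mkB_val (by simp at hb; omega)
        have hne : ∃ Y Ys, β' ++ [X] = Y :: Ys := by
          cases β' with
          | nil => exact ⟨X, [], rfl⟩
          | cons y ys => exact ⟨y, ys ++ [X], rfl⟩
        obtain ⟨Y, Ys, hY⟩ := hne
        have hmap : ∀ k : ℕ, (Y, k) :: (Ys.map (fun Y => (Y, k)) ++ (Z, i) :: rest) =
            β'.map (fun Y => (Y, k)) ++ (X, k) :: (Z, i) :: rest := by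
          intro k
          have := congrArg (List.map (fun Y => (Y, k))) hY
          simp only [List.map_append, List.map_cons, List.map_nil] at this
          rw [← List.cons_append, ← this]
          simp
        cases d with
        | left => exact absurd htr (hM _ _ _ _ _)
        | up => have := M.up_pop _ _ _ _ _ htr; simp at this
        | down =>
          have hd : dM M m (q, ⟨[], hl⟩) (tapeNth w j) Z = .pushDown (p, mkB m β') X := by
            simp [dM, htr]
          rw [hd]
          left
          simp [DPPDA.step, cfg, htr, hb', hY, hmap]
        | right =>
          have hd : dM M m (q, ⟨[], hl⟩) (tapeNth w j) Z = .pushRight (p, mkB m β') X := by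
            simp [dM, htr]
          rw [hd]
          simp [StepSpec, DPPDA.step, cfg, htr, hb', hY, hmap]
  · have hb' : (mkB m l').1 = l' := mkB_val (by simp at hl; omega)
    have hd : dM M m (q, ⟨l'.concat X, hl⟩) (tapeNth w j) Z = .pushDown (q, mkB m l') X := by
      simp [dM]
    rw [hd]
    right
    simp [cfg, hb']

theorem noRight_dM (M : DPPDA Q A Γ) (m : ℕ) : NoRight (dM M m) := by
  intro s Z
  constructor
  · intro p h
    unfold dM at h
    split at h
    · simp at h
    · split at h
      · simp at h
      · rename_i p β d htr
        split at h <;> simp at h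
        exact M.no_right_rmark _ _ _ _ htr
  · intro p X h
    unfold dM at h
    split at h
    · simp at h
    · split at h
      · simp at h
      · rename_i p β d htr
        split at h <;> simp at h
        exact M.no_right_rmark _ _ _ _ htr

section
variable {M : DPPDA Q A Γ} (hM : M.OneWay) {m : ℕ}
    (hm : ∀ q t Z p β d, M.trans q t Z = some (p, β, d) → β.length ≤ m) (w : List A)
include hM hm

theorem big_nil {h s Z j p o} (H : Big (dM M m) w h s Z j p o) : p.2.1 = [] := by
  induction H with
  | @popDown s Z j p e => have := stepSpec hM hm w s j Z 0 []; rw [e] at this; exact this.2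
  | @popRight s Z j p e => have := stepSpec hM hm w s j Z 0 []; rw [e] at this; exact this.2
  | @popUp s Z j p e => have := stepSpec hM hm w s j Z 0 []; rw [e] at this; exact this.2
  | pushDown _ _ _ _ ih => exact ih
  | pushRight _ _ _ _ ih => exact ih

theorem big_reaches {h s Z j p o} (H : Big (dM M m) w h s Z j p o) :
    ∀ i rest, M.Reaches w (cfg s j ((Z, i) :: rest)) (cfg p (o.getD i) rest) := by
  induction H with
  | @popDown s Z j p e =>
    intro i rest
    have := stepSpec hM hm w s j Z i rest
    rw [e] at this
    exact Relation.ReflTransGen.single this.1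
  | @popRight s Z j p e =>
    intro i rest
    have := stepSpec hM hm w s j Z i rest
    rw [e] at this
    exact Relation.ReflTransGen.single this.1
  | @popUp s Z j p e =>
    intro i rest
    have := stepSpec hM hm w s j Z i rest
    rw [e] at this
    exact Relation.ReflTransGen.single this.1
  | @pushDown s Z j s' X h₁ r o h₂ p o' e _ _ ih1 ih2 =>
    intro i rest
    have := stepSpec hM hm w s j Z i rest
    rw [e] at this
    have hrest := (ih1 j ((Z, i) :: rest)).trans (ih2 i rest)
    rcases this with h | ⟨h, _⟩
    · exact Relation.ReflTransGen.head h hrest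
    · rw [h]; exact hrest
  | @pushRight s Z j s' X h₁ r o h₂ p o' e _ _ ih1 ih2 =>
    intro i rest
    have := stepSpec hM hm w s j Z i rest
    rw [e] at this
    exact Relation.ReflTransGen.head this ((ih1 (j + 1) ((Z, i) :: rest)).trans (ih2 i rest))

omit hM hm in
/-- Reachability in a given number of steps. -/
def RN (M : DPPDA Q A Γ) (w : List A) : ℕ → Conf Q Γ → Conf Q Γ → Prop
  | 0, c, c' => c = c'
  | n + 1, c, c' => ∃ d, M.step w c = some d ∧ RN M w n d c'

omit hM hm in
theorem exists_RN {c c' : Conf Q Γ} (h : M.Reaches w c c') : ∃ n, RN M w n c c' := by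
  induction h using Relation.ReflTransGen.head_induction_on with
  | refl => exact ⟨0, rfl⟩
  | head h _ ih =>
    obtain ⟨n, hn⟩ := ih
    exact ⟨n + 1, _, h, hn⟩

theorem RN_big (qf : Q) (e : ℕ) (n : ℕ) : ∀ (len : ℕ) (s : PS Q Γ m) (Z : Γ) (j i : ℕ)
    (rest : List (Γ × ℕ)), s.2.1.length = len →
    RN M w n (cfg s j ((Z, i) :: rest)) ⟨qf, [], e⟩ →
    ∃ h p o n', n' < n ∧ Big (dM M m) w h s Z j p o ∧
      RN M w n' (cfg p (o.getD i) rest) ⟨qf, [], e⟩ := by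
  induction n using Nat.strong_induction_on with
  | _ n ihn =>
    intro len
    induction len using Nat.strong_induction_on with
    | _ len ihl =>
      intro s Z j i rest hlen hrun
      have hstep : ∀ {c'}, M.step w (cfg s j ((Z, i) :: rest)) = c' →
          ∃ n0 d, n = n0 + 1 ∧ c' = some d ∧ RN M w n0 d ⟨qf, [], e⟩ := by
        intro c' hc
        cases n with
        | zero =>
          have := congrArg Conf.stack hrun
          simp [cfg] at this
        | succ n0 =>
          obtain ⟨d, hd, hr⟩ := hrun
          exact ⟨n0, d, rfl, hc ▸ hd, hr⟩
      have hsp := stepSpec hM hm w s j Z i rest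
      cases hδ : dM M m s (tapeNth w j) Z with
      | stuck =>
        rw [hδ] at hsp
        obtain ⟨n0, d, _, h, _⟩ := hstep hsp
        simp at h
      | popDown p =>
        rw [hδ] at hsp
        obtain ⟨n0, d, rfl, h, hr⟩ := hstep hsp.1
        cases h
        exact ⟨_, p, _, n0, by omega, .popDown hδ, hr⟩
      | popRight p =>
        rw [hδ] at hsp
        obtain ⟨n0, d, rfl, h, hr⟩ := hstep hsp.1
        cases h
        exact ⟨_, p, _, n0, by omega, .popRight hδ, hr⟩
      | popUp p =>
        rw [hδ] at hsp
        obtain ⟨n0, d, rfl, h, hr⟩ := hstep hsp.1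
        cases h
        exact ⟨_, p, _, n0, by omega, .popUp hδ, hr⟩
      | pushDown s' X =>
        rw [hδ] at hsp
        rcases hsp with hsp | ⟨hsp, hlt⟩
        · obtain ⟨n0, d, rfl, h, hr⟩ := hstep hsp
          cases h
          obtain ⟨h1, r, o, n1, hn1, H1, hr1⟩ := ihn n0 (by omega) _ _ _ _ _ _ rfl hr
          obtain ⟨h2, p, o', n2, hn2, H2, hr2⟩ := ihn n1 (by omega) _ _ _ _ _ _ rfl hr1
          exact ⟨_, p, o', n2, by omega, .pushDown hδ H1 H2, hr2⟩
        · rw [hsp] at hrun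
          obtain ⟨h1, r, o, n1, hn1, H1, hr1⟩ := ihl _ (by omega) _ _ _ _ _ rfl hrun
          obtain ⟨h2, p, o', n2, hn2, H2, hr2⟩ := ihn n1 (by omega) _ _ _ _ _ _ rfl hr1
          exact ⟨_, p, o', n2, by omega, .pushDown hδ H1 H2, hr2⟩
      | pushRight s' X =>
        rw [hδ] at hsp
        obtain ⟨n0, d, rfl, h, hr⟩ := hstep hsp
        cases h
        obtain ⟨h1, r, o, n1, hn1, H1, hr1⟩ := ihn n0 (by omega) _ _ _ _ _ _ rfl hr
        obtain ⟨h2, p, o', n2, hn2, H2, hr2⟩ := ihn n1 (by omega) _ _ _ _ _ _ rfl hr1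
        exact ⟨_, p, o', n2, by omega, .pushRight hδ H1 H2, hr2⟩

theorem accepts_iff : M.Accepts w ↔ ∃ p : PS Q Γ m, M.final p.1 = true ∧
    ∃ h, Big (dM M m) w h (M.init, mkB m []) M.Z0 0 p (some (w.length + 1)) := by
  have hc : (⟨M.init, [(M.Z0, 0)], 0⟩ : Conf Q Γ) =
      cfg ((M.init, mkB m []) : PS Q Γ m) 0 [(M.Z0, 0)] := by
    simp [cfg, mkB]
  constructor
  · rintro ⟨qf, hqf, hr⟩
    rw [hc] at hr
    obtain ⟨n, hn⟩ := exists_RN w hr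
    obtain ⟨h, p, o, n', _, H, hr'⟩ := RN_big hM hm w qf _ n _ _ _ _ _ _ rfl hn
    have hnil := big_nil hM hm w H
    cases n' with
    | succ n' =>
      obtain ⟨d, hd, _⟩ := hr'
      simp [cfg, hnil, DPPDA.step] at hd
    | zero =>
      simp only [RN, cfg, hnil, List.map_nil, List.append_nil, Conf.mk.injEq] at hr'
      obtain ⟨h1, _, h3⟩ := hr'
      cases o with
      | none => simp at h3
      | some k =>
        simp at h3
        subst h3
        exact ⟨p, by rw [h1]; exact hqf, h, H⟩
  · rintro ⟨p, hp, h, H⟩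
    refine ⟨p.1, hp, ?_⟩
    have := big_reaches hM hm w H 0 []
    rw [hc]
    simpa [cfg, big_nil hM hm w H] using this

end

instance [Finite A] : Finite (TSym A) := by
  let f : TSym A → Option (Option A) := fun s => match s with
    | .lmark => none
    | .rmark => some none
    | .sym a => some (some a)
  refine Finite.of_injective f ?_
  intro a b h
  cases a <;> cases b <;> simp_all [f]

theorem dppda_to_pel [Finite A] {L : Set (List A)} (h : RecognizedByDPPDA L) : IsPEL L := by
  classical
  rcases isEmpty_or_nonempty A with hA | ⟨⟨a0⟩⟩
  · by_cases hL : [] ∈ L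
    · refine ⟨Unit, inferInstance, ⟨fun _ => .eps, ()⟩, ?_, ?_⟩
      · intro B hB
        obtain ⟨c, hc, _⟩ := Relation.TransGen.head'_iff.1 hB
        simp [PExp.leftNts] at hc
      · ext w
        have : w = [] := Subsingleton.elim _ _
        subst this
        exact ⟨fun _ => hL, fun _ => .nt (.eps [])⟩
    · refine ⟨Unit, inferInstance, ⟨fun _ => .not .eps, ()⟩, ?_, ?_⟩
      · intro B hB
        obtain ⟨c, hc, _⟩ := Relation.TransGen.head'_iff.1 hB
        simp [PExp.leftNts] at hc
      · ext w
        have : w = [] := Subsingleton.elim _ _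
        subst this
        refine ⟨fun h => ?_, fun h => absurd h hL⟩
        cases h with
        | nt h => cases h with
          | not_succ h => cases h
  · obtain ⟨Q, Γ, hQ, hΓ, M, hM, hL⟩ := h
    have hbd : ∃ m, ∀ q t Z p β d, M.trans q t Z = some (p, β, d) → β.length ≤ m := by
      obtain ⟨m, hm⟩ := (Set.finite_range (fun x : Q × TSym A × Γ =>
        match M.trans x.1 x.2.1 x.2.2 with
        | none => 0
        | some y => y.2.1.length)).bddAbove
      refine ⟨m, fun q t Z p β d h => ?_⟩
      have := hm (Set.mem_range_self (q, t, Z))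
      simpa [h] using this
    obtain ⟨m, hm⟩ := hbd
    have hfl : Finite {l : List Γ // l.length ≤ m} := List.finite_length_le Γ m
    letI : Fintype (PS Q Γ m) := Fintype.ofFinite _
    letI : Fintype A := Fintype.ofFinite _
    refine ⟨NT (PS Q Γ m) Γ, inferInstance, gr (dM M m) a0 Finset.univ.toList Finset.univ.toList
      (Nat.card (PS Q Γ m × Γ)) (M.init, mkB m []) M.Z0
      (Finset.univ.toList.filter fun p => M.final p.1), gr_wf _ _ _ _ _ _ _ _, ?_⟩
    ext w
    rw [gr_correct (noRight_dM M m) (by simp) (by simp) le_rfl, ← hL w, accepts_iff hM hm w]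
    simp

end fromMachine

end PelProof

/-- A language is a parsing expression language iff it is
recognized by some one-way deterministic pointer pushdown automaton. -/
theorem pel_iff_dppda {A : Type} [Finite A] (L : Set (List A)) :
    IsPEL L ↔ RecognizedByDPPDA L := by
  exact ⟨PelProof.pel_to_dppda, PelProof.dppda_to_pel⟩
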